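/- arXiv:0903.2864 — 2 statements merged into one kernel-verified Lean document; each statement's English description precedes it below -/
import Mathlib

section
/- Let n ≥ 7 and let 2 ≤ k ≤ n. Let x be a permutation of {1,…,n} whose set of fixed points is exactly {k+1,…,n} (so, regarded as an element of S_k acting on {1,…,k}, x is fixed-point-free), and let H = C_{S_n}(x) be its centralizer. Let θ be either the trivial character or the sign character of the symmetric group on {k+1,…,n}, and let χ_θ be the one-dimensional character of H given by χ_θ(g) = θ(g|_{{k+1,…,n}}) (every g ∈ H preserves the fixed-point set of x). Then the induced character Ind_H^{S_n}(χ_θ) is multiplicity-free if and only if either x is a 2-cycle and k = 2, or x is a 3-cycle and k = 3, or x is an involution with no fixed points among {1,…,k} (cycle type (2^{k/2})) and θ is the sign character. Equivalently, in representation-theoretic terms: for every irreducible finite-dimensional complex representation V of S_n, the dimension of the subspace {v ∈ V : g·v = χ_θ(g)v for all g ∈ H} is at most 1, if and only if one of the three listed conditions holds. -/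
/-- The subspace of a representation `V` on which every element `h` of the subgroup `H`
acts by the scalar `χ h`. Its dimension is the multiplicity of `V` in the character
induced from the one-dimensional character `χ` of `H`. -/
noncomputable def relEigenspace {G : Type} [Group G] {H : Subgroup G}
    (V : FDRep ℂ G) (χ : H → ℂ) : Submodule ℂ V where
  carrier := {v | ∀ h : H, V.ρ h v = χ h • v}
  zero_mem' := by intro h; simp
  add_mem' := by
    intro a b ha hb h
    simp [map_add, ha h, hb h, smul_add]
  smul_mem' := by
    intro c v hv h
    rw [map_smul, hv h, smul_comm]

/-- The monomial character of `G` induced from the one-dimensional character `χ` of the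
subgroup `H` is multiplicity-free: in every irreducible complex representation of `G`,
the subspace on which `H` acts via `χ` is at most one-dimensional. -/
noncomputable def IsMultFreeRel {G : Type} [Group G] (H : Subgroup G) (χ : H → ℂ) : Prop :=
  ∀ V : FDRep ℂ G, CategoryTheory.Simple V →
    Module.finrank ℂ (relEigenspace V χ) ≤ 1

/-- An element of the centralizer of `x` permutes the fixed points of `x`; this is the
restriction of such an element to the set of fixed points of `x`. -/
def restrictFixed {n : ℕ} (x : Equiv.Perm (Fin n))
    (g : Subgroup.centralizer ({x} : Set (Equiv.Perm (Fin n)))) :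
    Equiv.Perm {i : Fin n // x i = i} :=
  Equiv.Perm.subtypePerm (g : Equiv.Perm (Fin n)) (by
    intro i
    have hc : x * (g : Equiv.Perm (Fin n)) = (g : Equiv.Perm (Fin n)) * x :=
      Subgroup.mem_centralizer_iff.mp g.2 x rfl
    have hxg : ∀ j : Fin n, x ((g : Equiv.Perm (Fin n)) j) = (g : Equiv.Perm (Fin n)) (x j) := by
      intro j
      have := Equiv.ext_iff.mp hc j
      simpa [Equiv.Perm.mul_apply] using this
    constructor
    · intro h
      rw [hxg] at h
      exact (g : Equiv.Perm (Fin n)).injective h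
    · intro h
      rw [hxg, h])

/-- The sign character of a symmetric group, with values in `ℂˣ`. -/
noncomputable def signComplex (α : Type*) [Fintype α] [DecidableEq α] :
    Equiv.Perm α →* ℂˣ :=
  (Units.map (Int.castRingHom ℂ).toMonoidHom).comp Equiv.Perm.sign

section Representations

open CategoryTheory

theorem eq_top_of_simple {G : Type} [Group G] (V : FDRep ℂ G) [Simple V]
    (p : Submodule ℂ V) (hp : ∀ g, ∀ v ∈ p, V.ρ g v ∈ p) (h0 : p ≠ ⊥) : p = ⊤ := by
  let σ : Subrepresentation V.ρ := ⟨p, fun g v hv => hp g v hv⟩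
  let i : FDRep.of σ.toRepresentation ⟶ V :=
    ⟨FGModuleCat.ofHom p.subtype, fun g => by ext; rfl⟩
  have hi : Function.Injective i := p.injective_subtype
  have : Mono i := ConcreteCategory.mono_of_injective i hi
  have hne : i ≠ 0 := by
    rintro h
    apply h0
    rw [Submodule.eq_bot_iff]
    intro v hv
    have : i ⟨v, hv⟩ = 0 := by rw [h]; rfl
    exact this
  have := isIso_of_mono_of_nonzero hne
  have hs : Function.Surjective i := by
    intro v
    refine ⟨(inv i) v, ?_⟩
    rw [← ConcreteCategory.comp_apply]
    simp
  rw [eq_top_iff]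
  intro v _
  obtain ⟨⟨w, hw⟩, rfl⟩ := hs v
  exact hw

theorem simple_fdRep_of_isSimpleModule {G : Type} [Group G] [Finite G]
    (M : Type) [AddCommGroup M] [Module ℂ M] [Module (MonoidAlgebra ℂ G) M]
    [IsScalarTower ℂ (MonoidAlgebra ℂ G) M] [FiniteDimensional ℂ M]
    [IsSimpleModule (MonoidAlgebra ℂ G) M] :
    Simple (FDRep.of (Representation.ofModule' (k := ℂ) (G := G) M)) := by
  rw [FDRep.simple_iff_end_is_rank_one]
  have hM := IsSimpleModule.nontrivial (MonoidAlgebra ℂ G) M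
  set V := FDRep.of (Representation.ofModule' (k := ℂ) (G := G) M)
  refine finrank_eq_one (𝟙 V) ?_ ?_
  · intro h
    obtain ⟨v, hv⟩ := exists_ne (0 : M)
    apply hv
    have : (𝟙 V : V ⟶ V) v = (0 : V ⟶ V) v := by rw [h]
    exact this
  · intro f
    let l : M →ₗ[ℂ] M := f.hom.hom.hom
    have hl : ∀ g : G, ∀ m : M,
        l (MonoidAlgebra.single g (1:ℂ) • m) = MonoidAlgebra.single g (1:ℂ) • l m := by
      intro g m
      have := ConcreteCategory.congr_hom (f.comm g) m
      exact this
    let F : M →ₗ[MonoidAlgebra ℂ G] M :=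
      { l with
        map_smul' := by
          intro a m
          induction a using MonoidAlgebra.induction_linear with
          | zero => simp [zero_smul]
          | add x y hx hy => simp_all [add_smul]
          | single g c =>
            have e : MonoidAlgebra.single g c = c • MonoidAlgebra.single g (1:ℂ) := by simp
            rw [e, smul_assoc, RingHom.id_apply, smul_assoc]
            change l (c • _) = c • _
            rw [map_smul, hl]
            rfl }
    obtain ⟨c, hc⟩ := (IsSimpleModule.algebraMap_end_bijective_of_isAlgClosed
      (A := MonoidAlgebra ℂ G) (V := M) ℂ).2 F
    refine ⟨c, ?_⟩
    ext m
    have := LinearMap.congr_fun hc m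
    exact this

/-- The unnormalized projection of a representation of `G` onto the subspace on which the
subgroup `H` acts via the character `χ`. -/
noncomputable def charSum {G V : Type} [Group G] [AddCommGroup V] [Module ℂ V]
    {H : Subgroup G} [Fintype H] (ρ : Representation ℂ G V) (χ : H →* ℂˣ) : Module.End ℂ V :=
  ∑ h : H, ((χ h)⁻¹ : ℂˣ).val • ρ h

section charSum

variable {G V : Type} [Group G] [AddCommGroup V] [Module ℂ V]
  {H : Subgroup G} [Fintype H] (ρ : Representation ℂ G V) (χ : H →* ℂˣ)

theorem mul_charSum (h : H) : ρ h * charSum ρ χ = (χ h : ℂ) • charSum ρ χ := by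
  unfold charSum
  rw [Finset.mul_sum, Finset.smul_sum]
  refine Fintype.sum_equiv (Equiv.mulLeft h) _ _ fun k => ?_
  simp [smul_smul, map_mul, mul_comm]

theorem charSum_mul (h : H) : charSum ρ χ * ρ h = (χ h : ℂ) • charSum ρ χ := by
  unfold charSum
  rw [Finset.sum_mul, Finset.smul_sum]
  refine Fintype.sum_equiv (Equiv.mulRight h) _ _ fun k => ?_
  simp [smul_smul, map_mul]

theorem charSum_mul_charSum :
    charSum ρ χ * charSum ρ χ = (Fintype.card H : ℂ) • charSum ρ χ := by
  conv_lhs => enter [1]; unfold charSum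
  rw [Finset.sum_mul]
  simp [mul_charSum, smul_smul, Nat.cast_smul_eq_nsmul]

theorem apply_charSum_apply (h : H) (v : V) :
    ρ h (charSum ρ χ v) = (χ h : ℂ) • charSum ρ χ v :=
  LinearMap.congr_fun (mul_charSum ρ χ h) v

theorem charSum_apply_of_forall {v : V} (hv : ∀ h : H, ρ h v = (χ h : ℂ) • v) :
    charSum ρ χ v = (Fintype.card H : ℂ) • v := by
  simp [charSum, LinearMap.sum_apply, hv, smul_smul, Nat.cast_smul_eq_nsmul]

theorem charSum_mul_mul_charSum_of_left_right (g g' : G) (h₁ h₂ : H) (hg : h₁ * g * h₂ = g') :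
    charSum ρ χ * ρ g' * charSum ρ χ
      = ((χ h₁ : ℂ) * χ h₂) • (charSum ρ χ * ρ g * charSum ρ χ) := by
  calc charSum ρ χ * ρ g' * charSum ρ χ
      = (charSum ρ χ * ρ h₁) * ρ g * (ρ h₂ * charSum ρ χ) := by
        rw [← hg]; simp only [map_mul, mul_assoc]
    _ = _ := by
        rw [charSum_mul, mul_charSum]
        simp only [smul_mul_assoc, mul_smul_comm, smul_smul]
        rw [mul_comm]

theorem card_ne_zero_complex : (Fintype.card H : ℂ) ≠ 0 := by
  exact_mod_cast Fintype.card_ne_zero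

/-- For a real character, the anti-automorphism `g ↦ g⁻¹` fixes `charSum`. -/
theorem charSum_eq_sum_inv (hχ : ∀ h, χ h * χ h = 1) :
    charSum ρ χ = ∑ h : H, ((χ h)⁻¹ : ℂˣ).val • ρ (h : G)⁻¹ := by
  unfold charSum
  refine Fintype.sum_equiv (Equiv.inv H) _ _ fun k => ?_
  have : (χ k)⁻¹ = χ k := inv_eq_of_mul_eq_one_left (hχ k)
  simp [this]

theorem charSum_mul_mul_charSum_mul_mul_charSum (a b : G) :
    charSum ρ χ * ρ a * charSum ρ χ * ρ b * charSum ρ χ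
      = ∑ h : H, ((χ h)⁻¹ : ℂˣ).val • (charSum ρ χ * ρ (a * h * b) * charSum ρ χ) := by
  conv_lhs => enter [1, 1, 2]; unfold charSum
  simp only [Finset.mul_sum, Finset.sum_mul, map_mul, mul_smul_comm, smul_mul_assoc, mul_assoc]

theorem commute_charSum_of_symm (hχ : ∀ h, χ h * χ h = 1)
    (hs : ∀ g : G, charSum ρ χ * ρ g * charSum ρ χ = charSum ρ χ * ρ g⁻¹ * charSum ρ χ)
    (a b : G) :
    Commute (charSum ρ χ * ρ a * charSum ρ χ) (charSum ρ χ * ρ b * charSum ρ χ) := by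
  have key : charSum ρ χ * ρ a * charSum ρ χ * ρ b * charSum ρ χ
      = charSum ρ χ * ρ b * charSum ρ χ * ρ a * charSum ρ χ := by
    have e1 : charSum ρ χ * ρ a * charSum ρ χ * ρ b * charSum ρ χ
        = charSum ρ χ * ρ b⁻¹ * charSum ρ χ * ρ a⁻¹ * charSum ρ χ := by
      rw [charSum_mul_mul_charSum_mul_mul_charSum]
      conv_rhs => enter [1, 1, 2]; rw [charSum_eq_sum_inv ρ χ hχ]
      simp only [Finset.mul_sum, Finset.sum_mul, mul_smul_comm, smul_mul_assoc]
      refine Finset.sum_congr rfl fun h _ => ?_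
      rw [hs]
      simp only [mul_inv_rev, map_mul, mul_assoc]
    refine smul_right_injective _ (card_ne_zero_complex (H := H)) ?_
    have e2 : ∀ c d : G, (Fintype.card H : ℂ) •
        (charSum ρ χ * ρ c * charSum ρ χ * ρ d * charSum ρ χ) =
        (charSum ρ χ * ρ c * charSum ρ χ) * (charSum ρ χ * ρ d * charSum ρ χ) := by
      intro c d
      calc _ = charSum ρ χ * ρ c * ((Fintype.card H : ℂ) • charSum ρ χ) * ρ d * charSum ρ χ := by
            simp only [mul_smul_comm, smul_mul_assoc]
        _ = _ := by rw [← charSum_mul_charSum]; simp only [mul_assoc]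
    simp only
    rw [e1, e2, e2, ← hs, ← hs]
  have e3 : ∀ c d : G, (charSum ρ χ * ρ c * charSum ρ χ) * (charSum ρ χ * ρ d * charSum ρ χ)
      = (Fintype.card H : ℂ) • (charSum ρ χ * ρ c * charSum ρ χ * ρ d * charSum ρ χ) := by
    intro c d
    calc _ = charSum ρ χ * ρ c * (charSum ρ χ * charSum ρ χ) * ρ d * charSum ρ χ := by
          simp only [mul_assoc]
      _ = _ := by rw [charSum_mul_charSum]; simp only [mul_smul_comm, smul_mul_assoc]
  rw [commute_iff_eq, e3, e3, key]

end charSum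

/-- Gelfand's trick for a real one-dimensional character of a subgroup. -/
theorem isMultFreeRel_of_charSum_symm {G : Type} [Group G] {H : Subgroup G} [Fintype H]
    (χ : H →* ℂˣ) (hχ : ∀ h, χ h * χ h = 1)
    (hs : ∀ (V : FDRep ℂ G) (g : G), charSum V.ρ χ * V.ρ g * charSum V.ρ χ
      = charSum V.ρ χ * V.ρ g⁻¹ * charSum V.ρ χ) :
    IsMultFreeRel H (fun h => (χ h : ℂ)) := by
  intro V hV
  set W := relEigenspace V (fun h => (χ h : ℂ)) with hWdef
  set E : Module.End ℂ V := charSum V.ρ χ with hE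
  set N : ℂ := (Fintype.card H : ℂ) with hN
  have hN0 : N ≠ 0 := card_ne_zero_complex (H := H)
  have hEW : ∀ v, E v ∈ W := fun v h => apply_charSum_apply V.ρ χ h v
  have hWE : ∀ v ∈ W, E v = N • v := fun v hv => charSum_apply_of_forall V.ρ χ hv
  have hspan : ∀ v ∈ W, v ≠ 0 → ∀ w ∈ W,
      w ∈ Submodule.span ℂ (Set.range fun b : G => (E * V.ρ b * E) v) := by
    intro v hv hv0 w hw
    set p : Submodule ℂ V := Submodule.span ℂ (Set.range fun b : G => V.ρ b v) with hp
    have hpt : p = ⊤ := by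
      refine eq_top_of_simple V p ?_ ?_
      · intro g u hu
        have : p ≤ p.comap (V.ρ g) := by
          rw [hp, Submodule.span_le]
          rintro _ ⟨b, rfl⟩
          refine Submodule.subset_span ⟨g * b, ?_⟩
          simp [map_mul]
        exact this hu
      · intro h0
        apply hv0
        have : v ∈ p := Submodule.subset_span ⟨1, by simp⟩
        rw [h0] at this
        exact this
    have hw' : w ∈ p := by rw [hpt]; trivial
    have h1 : E w ∈ Submodule.span ℂ (Set.range fun b : G => (E * V.ρ b * E) v) := by
      have : p ≤ (Submodule.span ℂ (Set.range fun b : G => (E * V.ρ b * E) v)).comap E := by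
        rw [hp, Submodule.span_le]
        rintro _ ⟨b, rfl⟩
        have e : E (V.ρ b v) = N⁻¹ • (E * V.ρ b * E) v := by
          simp [Module.End.mul_apply, hWE v hv, smul_smul, hN0]
        simp only [Submodule.comap_coe, Set.mem_preimage, SetLike.mem_coe, e]
        exact Submodule.smul_mem _ _ (Submodule.subset_span ⟨b, rfl⟩)
      exact this hw'
    rw [hWE w hw] at h1
    exact (Submodule.smul_mem_iff _ hN0).1 h1
  have hscal : ∀ a : G, ∃ μ : ℂ, ∀ w ∈ W, (E * V.ρ a * E) w = μ • w := by
    intro a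
    by_cases hW0 : W = ⊥
    · refine ⟨0, fun w hw => ?_⟩
      rw [hW0, Submodule.mem_bot] at hw
      simp [hw]
    have : Nontrivial W := Submodule.nontrivial_iff_ne_bot.2 hW0
    let T : Module.End ℂ W := (E * V.ρ a * E).restrict (fun v _ => hEW _)
    obtain ⟨μ, hμ⟩ := Module.End.exists_eigenvalue T
    obtain ⟨⟨v, hv⟩, hve⟩ := hμ.exists_hasEigenvector
    have hv0 : v ≠ 0 := fun h => hve.2 (Subtype.ext h)
    have hTv : (E * V.ρ a * E) v = μ • v := congrArg Subtype.val hve.apply_eq_smul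
    refine ⟨μ, fun w hw => ?_⟩
    have hle : Submodule.span ℂ (Set.range fun b : G => (E * V.ρ b * E) v)
        ≤ LinearMap.ker (E * V.ρ a * E - μ • 1) := by
      rw [Submodule.span_le]
      rintro _ ⟨b, rfl⟩
      have hc := commute_charSum_of_symm V.ρ χ hχ (hs V) a b
      have : (E * V.ρ a * E) ((E * V.ρ b * E) v) = (E * V.ρ b * E) ((E * V.ρ a * E) v) :=
        LinearMap.congr_fun hc.eq v
      rw [hTv, map_smul] at this
      simp only [SetLike.mem_coe, LinearMap.mem_ker, LinearMap.sub_apply, this]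
      simp
    have := hle (hspan v hv hv0 w hw)
    simpa [sub_eq_zero] using this
  by_cases hW0 : W = ⊥
  · rw [hW0]; simp
  obtain ⟨v, hv, hv0⟩ := Submodule.exists_mem_ne_zero_of_ne_bot hW0
  refine finrank_le_one (⟨v, hv⟩ : W) fun w => ?_
  have hle : Submodule.span ℂ (Set.range fun b : G => (E * V.ρ b * E) v) ≤ ℂ ∙ v := by
    rw [Submodule.span_le]
    rintro _ ⟨b, rfl⟩
    obtain ⟨μ, hμ⟩ := hscal b
    exact Submodule.mem_span_singleton.2 ⟨μ, (hμ v hv).symm⟩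
  obtain ⟨c, hc⟩ := Submodule.mem_span_singleton.1 (hle (hspan v hv hv0 w w.2))
  exact ⟨c, Subtype.ext hc⟩

/-- If every `g` either lies in the double coset of `g⁻¹` with trivial twist or has a vanishing
`χ`-twisted double coset, then the character induced from `χ` is multiplicity-free. -/
theorem isMultFreeRel_of_forall_exists {G : Type} [Group G] [Finite G] {H : Subgroup G}
    (χ : H →* ℂˣ) (hχ : ∀ h, χ h * χ h = 1)
    (hg : ∀ g : G, (∃ h₁ h₂ : H, h₁ * g * h₂ = g⁻¹ ∧ χ h₁ * χ h₂ = 1) ∨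
      ∃ h₁ h₂ : H, h₁ * g * h₂ = g ∧ χ h₁ * χ h₂ ≠ 1) :
    IsMultFreeRel H (fun h => (χ h : ℂ)) := by
  have := Fintype.ofFinite H
  refine isMultFreeRel_of_charSum_symm χ hχ fun V g => ?_
  have hzero : ∀ (g : G) (h₁ h₂ : H), h₁ * g * h₂ = g → χ h₁ * χ h₂ ≠ 1 →
      charSum V.ρ χ * V.ρ g * charSum V.ρ χ = 0 := by
    intro g h₁ h₂ h1 h2
    have := charSum_mul_mul_charSum_of_left_right V.ρ χ g g h₁ h₂ h1
    have h3 : (1 - (χ h₁ : ℂ) * χ h₂) • (charSum V.ρ χ * V.ρ g * charSum V.ρ χ) = 0 := by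
      rw [sub_smul, ← this, one_smul, sub_self]
    refine (smul_eq_zero.1 h3).resolve_left fun h4 => h2 ?_
    rw [sub_eq_zero] at h4
    ext
    simpa using h4.symm
  obtain ⟨h₁, h₂, h1, h2⟩ | ⟨h₁, h₂, h1, h2⟩ := hg g
  · rw [charSum_mul_mul_charSum_of_left_right V.ρ χ g g⁻¹ h₁ h₂ h1, ← Units.val_mul, h2]
    simp
  · rw [hzero g h₁ h₂ h1 h2, hzero g⁻¹ h₂⁻¹ h₁⁻¹ ?_ ?_]
    · conv_rhs => rw [← h1]
      simp [mul_assoc]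
    · rw [map_inv, map_inv, ← mul_inv, mul_comm, Ne, inv_eq_one]
      exact h2

theorem trace_mul_charSum_inv {G : Type} [Group G] {H : Subgroup G} [Fintype H]
    (χ : H →* ℂˣ) (hχ : ∀ h, χ h * χ h = 1) (hamb : ∀ g : G, IsConj g g⁻¹)
    {V : Type} [AddCommGroup V] [Module ℂ V] (ρ : Representation ℂ G V) (g : G) :
    LinearMap.trace ℂ V (ρ g⁻¹ * charSum ρ χ) = LinearMap.trace ℂ V (ρ g * charSum ρ χ) := by
  have hinv : ∀ a : G, LinearMap.trace ℂ V (ρ a⁻¹) = LinearMap.trace ℂ V (ρ a) := by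
    intro a
    obtain ⟨c, hc⟩ := isConj_iff.1 (hamb a)
    rw [← hc, map_mul, LinearMap.trace_mul_comm, ← map_mul]
    simp
  have hcomm : ∀ a b : G, LinearMap.trace ℂ V (ρ (a * b)) = LinearMap.trace ℂ V (ρ (b * a)) := by
    intro a b
    rw [map_mul, LinearMap.trace_mul_comm, ← map_mul]
  conv_lhs => rw [charSum_eq_sum_inv ρ χ hχ]
  simp only [charSum, Finset.mul_sum, map_sum, mul_smul_comm, map_smul, ← map_mul]
  refine Finset.sum_congr rfl fun h _ => ?_
  rw [← mul_inv_rev, hinv, hcomm]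

theorem charSum_symm_of_finrank_le_one {G : Type} [Group G] {H : Subgroup G} [Fintype H]
    (χ : H →* ℂˣ) (hχ : ∀ h, χ h * χ h = 1) (hamb : ∀ g : G, IsConj g g⁻¹)
    (V : FDRep ℂ G) (hV : Module.finrank ℂ (relEigenspace V (fun h : H => (χ h : ℂ))) ≤ 1)
    (g : G) :
    charSum V.ρ χ * V.ρ g * charSum V.ρ χ = charSum V.ρ χ * V.ρ g⁻¹ * charSum V.ρ χ := by
  set E : Module.End ℂ V := charSum V.ρ χ with hE
  set W := relEigenspace V (fun h : H => (χ h : ℂ)) with hW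
  have hEW : ∀ v, E v ∈ W := fun v h => apply_charSum_apply V.ρ χ h v
  have hN0 : (Fintype.card H : ℂ) ≠ 0 := card_ne_zero_complex
  obtain ⟨⟨v, hv⟩, hvW⟩ := finrank_le_one_iff.1 hV
  have hline : ∀ u ∈ W, ∃ c : ℂ, u = c • v := fun u hu => by
    obtain ⟨c, hc⟩ := hvW ⟨u, hu⟩
    exact ⟨c, (congrArg Subtype.val hc).symm⟩
  have hscal : ∀ a : G, ∃ α : ℂ, E * V.ρ a * E = α • E := by
    intro a
    obtain ⟨α, hα⟩ := hline (E (V.ρ a v)) (hEW _)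
    refine ⟨α, LinearMap.ext fun u => ?_⟩
    obtain ⟨c, hc⟩ := hline (E u) (hEW u)
    simp only [Module.End.mul_apply, LinearMap.smul_apply, hc, map_smul, hα, smul_smul, mul_comm]
  have htr : ∀ a α, E * V.ρ a * E = α • E →
      (Fintype.card H : ℂ) * LinearMap.trace ℂ V (V.ρ a * E) = α * LinearMap.trace ℂ V E := by
    intro a α h
    have := congrArg (LinearMap.trace ℂ V) h
    rwa [LinearMap.trace_mul_comm, ← mul_assoc, LinearMap.trace_mul_comm, hE,
      charSum_mul_charSum, mul_smul_comm, map_smul, map_smul, smul_eq_mul, smul_eq_mul] at this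
  obtain ⟨α, hα⟩ := hscal g
  obtain ⟨β, hβ⟩ := hscal g⁻¹
  by_cases ht : LinearMap.trace ℂ V E = 0
  · have hid : IsIdempotentElem ((Fintype.card H : ℂ)⁻¹ • E) := by
      rw [IsIdempotentElem, smul_mul_smul_comm, hE, charSum_mul_charSum, smul_smul]
      congr 1
      field_simp
    have h0 := (LinearMap.IsIdempotentElem.trace_eq_zero_iff hid).1 (by simp [ht])
    have : E = 0 := (smul_eq_zero.1 h0).resolve_left (inv_ne_zero hN0)
    rw [this]
    simp
  · have h1 := htr _ _ hα
    have h2 := htr _ _ hβ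
    rw [trace_mul_charSum_inv χ hχ hamb, h1] at h2
    rw [hα, hβ, mul_right_cancel₀ ht h2]

/-- If `G` is ambivalent and some `g` has a nonvanishing `χ`-twisted double coset `HgH`
which does not contain `g⁻¹`, then the character induced from the real character `χ` is not
multiplicity-free. -/
theorem not_isMultFreeRel {G : Type} [Group G] [Finite G] {H : Subgroup G}
    (χ : H →* ℂˣ) (hχ : ∀ h, χ h * χ h = 1) (hamb : ∀ g : G, IsConj g g⁻¹) (g : G)
    (hS : ∀ h₁ h₂ : H, h₁ * g * h₂ = g → χ h₁ * χ h₂ = 1)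
    (hN : ∀ h₁ h₂ : H, h₁ * g * h₂ ≠ g⁻¹) :
    ¬ IsMultFreeRel H (fun h => (χ h : ℂ)) := by
  classical
  intro hMF
  have := Fintype.ofFinite H
  have := Fintype.ofFinite G
  let δ : G → MonoidAlgebra ℂ G := fun a => MonoidAlgebra.single a (1 : ℂ)
  let e : MonoidAlgebra ℂ G := ∑ h : H, ((χ h)⁻¹ : ℂˣ).val • δ h
  have hann : ∀ S : Submodule (MonoidAlgebra ℂ G) (MonoidAlgebra ℂ G),
      IsSimpleModule (MonoidAlgebra ℂ G) S → ∀ s ∈ S, (e * δ g * e) * s = (e * δ g⁻¹ * e) * s := by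
    intro S hS s hs
    have : FiniteDimensional ℂ S :=
      inferInstanceAs (FiniteDimensional ℂ (S.restrictScalars ℂ))
    let V := FDRep.of (Representation.ofModule' (k := ℂ) (G := G) S)
    have hV := hMF V (simple_fdRep_of_isSimpleModule S)
    have hδ : ∀ (a : G) (t : S), ((V.ρ a t : S) : MonoidAlgebra ℂ G) = δ a * t :=
      fun a t => rfl
    have he : ∀ t : S, ((charSum V.ρ χ t : S) : MonoidAlgebra ℂ G) = e * t := by
      intro t
      have : charSum V.ρ χ t = ∑ h : H, ((χ h)⁻¹ : ℂˣ).val • (V.ρ h t : S) := by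
        simp only [charSum, LinearMap.sum_apply, LinearMap.smul_apply]
      rw [this, Submodule.coe_sum]
      simp only [e, Finset.sum_mul]
      refine Finset.sum_congr rfl fun h _ => ?_
      rw [smul_mul_assoc]
      rfl
    have key := LinearMap.congr_fun (charSum_symm_of_finrank_le_one χ hχ hamb V hV g) ⟨s, hs⟩
    have key' := congrArg (Subtype.val : S → MonoidAlgebra ℂ G) key
    simp only [Module.End.mul_apply] at key'
    erw [he, hδ, he, he, hδ, he] at key'
    simpa only [mul_assoc] using key'
  have hone : (e * δ g * e) * 1 = (e * δ g⁻¹ * e) * (1 : MonoidAlgebra ℂ G) := by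
    have h1 : (1 : MonoidAlgebra ℂ G) ∈
        ⨆ S : {S : Submodule (MonoidAlgebra ℂ G) (MonoidAlgebra ℂ G) //
            IsSimpleModule (MonoidAlgebra ℂ G) S},
          (S : Submodule (MonoidAlgebra ℂ G) (MonoidAlgebra ℂ G)) := by
      have := IsSemisimpleModule.sSup_simples_eq_top (MonoidAlgebra ℂ G) (MonoidAlgebra ℂ G)
      rw [sSup_eq_iSup'] at this
      erw [this]
      trivial
    refine Submodule.iSup_induction _ (motive := fun s => (e * δ g * e) * s = (e * δ g⁻¹ * e) * s)
      h1 (fun S s hs => hann S S.2 s hs) (by simp) fun s t hs ht => by rw [mul_add, hs, ht, mul_add]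
  have hcoef : ∀ a : G, (e * δ a * e).coeff g
      = ∑ h₁ : H, ∑ h₂ : H, if h₁ * a * h₂ = g then (((χ h₁ * χ h₂)⁻¹ : ℂˣ) : ℂ) else 0 := by
    intro a
    simp only [e, δ, Finset.sum_mul, Finset.mul_sum, smul_mul_assoc, mul_smul_comm,
      MonoidAlgebra.single_mul_single, MonoidAlgebra.coeff_sum, MonoidAlgebra.coeff_smul]
    rw [Finset.sum_comm]
    simp [Finsupp.single_apply, mul_comm, Finset.mul_sum]
  rw [mul_one, mul_one] at hone
  have hc := congrArg (fun z : MonoidAlgebra ℂ G => z.coeff g) hone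
  simp only [hcoef] at hc
  have hr : (∑ h₁ : H, ∑ h₂ : H,
      if h₁ * g⁻¹ * h₂ = g then (((χ h₁ * χ h₂)⁻¹ : ℂˣ) : ℂ) else 0) = 0 := by
    refine Finset.sum_eq_zero fun h₁ _ => Finset.sum_eq_zero fun h₂ _ => if_neg fun h => ?_
    apply hN h₂⁻¹ h₁⁻¹
    conv_rhs => rw [← h]
    simp [mul_assoc]
  have hl : (∑ h₁ : H, ∑ h₂ : H,
      if h₁ * g * h₂ = g then (((χ h₁ * χ h₂)⁻¹ : ℂˣ) : ℂ) else 0)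
      = ((∑ h₁ : H, ∑ h₂ : H, if h₁ * g * h₂ = g then 1 else 0 : ℕ) : ℂ) := by
    push_cast
    refine Finset.sum_congr rfl fun h₁ _ => Finset.sum_congr rfl fun h₂ _ => ?_
    split_ifs with h
    · rw [← Units.val_mul, hS h₁ h₂ h]
      simp
    · rfl
  rw [hl, hr, Nat.cast_eq_zero, Finset.sum_eq_zero_iff] at hc
  have := Finset.sum_eq_zero_iff.1 (hc 1 (Finset.mem_univ _)) 1 (Finset.mem_univ _)
  simp at this

end Representations

section Involutions

variable {α : Type*}

theorem mul_zpow_of_involutions {x y : Equiv.Perm α} (hx : x * x = 1) (hy : y * y = 1) (i : ℤ) :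
    x * (x * y) ^ i = (x * y) ^ (-i) * x := by
  have hx' : x⁻¹ = x := inv_eq_of_mul_eq_one_left hx
  have hy' : y⁻¹ = y := inv_eq_of_mul_eq_one_left hy
  have h : SemiconjBy x (x * y) (x * y)⁻¹ := by
    rw [SemiconjBy, mul_inv_rev, hx', hy', mul_assoc, hx, mul_one, ← mul_assoc, hx, one_mul]
  rw [zpow_neg, ← inv_zpow]
  exact h.zpow_right i

theorem mul_zpow_of_involutions' {x y : Equiv.Perm α} (hx : x * x = 1) (hy : y * y = 1) (i : ℤ) :
    y * (x * y) ^ i = (x * y) ^ (-i) * y := by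
  have h := mul_zpow_of_involutions hy hx (-i)
  have e : y * x = (x * y)⁻¹ := by
    rw [mul_inv_rev, inv_eq_of_mul_eq_one_left hx, inv_eq_of_mul_eq_one_left hy]
  rwa [e, inv_zpow', inv_zpow', neg_neg] at h

/-- The orbit equivalence relation of the dihedral group generated by two involutions. -/
def dihedralSetoid (x y : Equiv.Perm α) (hx : x * x = 1) (hy : y * y = 1) : Setoid α where
  r a b := ∃ i : ℤ, a = ((x * y) ^ i) b ∨ a = ((x * y) ^ i) (x b)
  iseqv := by
    have key : ∀ (i : ℤ) (c : α), x (((x * y) ^ i) c) = ((x * y) ^ (-i)) (x c) := fun i c =>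
      Equiv.congr_fun (mul_zpow_of_involutions hx hy i) c
    have hxx : ∀ c, x (x c) = c := fun c => Equiv.congr_fun hx c
    have hadd : ∀ (i j : ℤ) (c : α), ((x * y) ^ i) (((x * y) ^ j) c) = ((x * y) ^ (i + j)) c :=
      fun i j c => by rw [zpow_add]; rfl
    refine ⟨fun a => ⟨0, Or.inl (by simp)⟩, ?_, ?_⟩
    · rintro a b ⟨i, rfl | rfl⟩
      · exact ⟨-i, Or.inl (by simp)⟩
      · exact ⟨i, Or.inr (by simp [key, hxx])⟩
    · rintro a b c ⟨i, rfl | rfl⟩ ⟨j, rfl | rfl⟩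
      · exact ⟨i + j, Or.inl (by rw [hadd])⟩
      · exact ⟨i + j, Or.inr (by rw [hadd])⟩
      · exact ⟨i + -j, Or.inr (by rw [key, hadd])⟩
      · exact ⟨i + -j, Or.inl (by rw [key, hadd, hxx])⟩

theorem exists_involution_of_forall_orbit (s : Setoid α) {x y : Equiv.Perm α}
    (hx : ∀ a, s (x a) a)
    (h : ∀ b, ∃ f : α → α, ∀ a, s a b → s (f a) b ∧ f (f a) = a ∧ f (x a) = y (f a)) :
    ∃ t : Equiv.Perm α, t * t = 1 ∧ t * x = y * t := by
  choose f hf using h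
  let b : α → α := fun a => (Quotient.mk s a).out
  have hb : ∀ a, s a (b a) := fun a => s.symm (Quotient.mk_out a)
  have hbe : ∀ a c, s a c → b a = b c := fun a c hac =>
    congrArg Quotient.out (Quotient.sound hac)
  let t : α → α := fun a => f (b a) a
  have hst : ∀ a, s (t a) a := fun a => s.trans (hf (b a) a (hb a)).1 (s.symm (hb a))
  have htt : Function.Involutive t := by
    intro a
    change f (b (t a)) (t a) = a
    rw [hbe _ _ (hst a)]
    exact (hf (b a) a (hb a)).2.1
  refine ⟨htt.toPerm, Equiv.ext htt, Equiv.ext fun a => ?_⟩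
  change f (b (x a)) (x a) = y (f (b a) a)
  rw [hbe _ _ (hx a)]
  exact (hf (b a) a (hb a)).2.2

variable {x y : Equiv.Perm α} (hx : x * x = 1) (hy : y * y = 1)
include hx hy

theorem exists_local_involution_of_fixed {b : α} {j : ℤ} (hb : y b = b)
    (hj : x (((x * y) ^ j) b) = ((x * y) ^ j) b) :
    ∃ f : α → α, ∀ a, dihedralSetoid x y hx hy a b →
      dihedralSetoid x y hx hy (f a) b ∧ f (f a) = a ∧ f (x a) = y (f a) := by
  have key : ∀ (i : ℤ) (c : α), x (((x * y) ^ i) c) = ((x * y) ^ (-i)) (x c) := fun i c =>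
    Equiv.congr_fun (mul_zpow_of_involutions hx hy i) c
  have key' : ∀ (i : ℤ) (c : α), y (((x * y) ^ i) c) = ((x * y) ^ (-i)) (y c) := fun i c =>
    Equiv.congr_fun (mul_zpow_of_involutions' hx hy i) c
  have hyy : ∀ c, y (y c) = c := fun c => Equiv.congr_fun hy c
  have hadd : ∀ (i j : ℤ) (c : α), ((x * y) ^ i) (((x * y) ^ j) c) = ((x * y) ^ (i + j)) c :=
    fun i j c => by rw [zpow_add]; rfl
  have hxb : x b = ((x * y) ^ (1 : ℤ)) b := by simp [hb]
  have hper : ((x * y) ^ (1 - j)) b = ((x * y) ^ j) b := by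
    rw [key, hxb, hadd, neg_add_eq_sub] at hj
    exact hj
  have horb : ∀ a, dihedralSetoid x y hx hy a b → ∃ i : ℤ, a = ((x * y) ^ i) b := by
    rintro a ⟨i, rfl | rfl⟩
    · exact ⟨i, rfl⟩
    · exact ⟨i + 1, by rw [hxb, hadd]⟩
  refine ⟨fun a => y (((x * y) ^ (j - 1)) a), fun a ha => ?_⟩
  obtain ⟨i, rfl⟩ := horb a ha
  refine ⟨⟨-(j - 1 + i), Or.inl ?_⟩, ?_, ?_⟩
  · change y (((x * y) ^ (j - 1)) (((x * y) ^ i) b)) = _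
    rw [hadd, key', hb]
  · change y (((x * y) ^ (j - 1)) (y (((x * y) ^ (j - 1)) (((x * y) ^ i) b)))) = _
    rw [key' (j - 1) (y _), hyy, hadd, hadd]
    congr 2
    ring
  · change y (((x * y) ^ (j - 1)) (x (((x * y) ^ i) b)))
      = y (y (((x * y) ^ (j - 1)) (((x * y) ^ i) b)))
    rw [hyy, key, hxb, hadd, hadd, hadd, key', hb]
    have := congrArg ((x * y) ^ (i - 1)) hper
    rw [hadd, hadd] at this
    convert this using 3 <;> ring

theorem exists_local_involution_of_not_fixed {b : α}
    (hbx : ∀ a, dihedralSetoid x y hx hy a b → x a ≠ a)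
    (hby : ∀ a, dihedralSetoid x y hx hy a b → y a ≠ a) :
    ∃ f : α → α, ∀ a, dihedralSetoid x y hx hy a b →
      dihedralSetoid x y hx hy (f a) b ∧ f (f a) = a ∧ f (x a) = y (f a) := by
  classical
  have key : ∀ (i : ℤ) (c : α), x (((x * y) ^ i) c) = ((x * y) ^ (-i)) (x c) := fun i c =>
    Equiv.congr_fun (mul_zpow_of_involutions hx hy i) c
  have key' : ∀ (i : ℤ) (c : α), y (((x * y) ^ i) c) = ((x * y) ^ (-i)) (y c) := fun i c =>
    Equiv.congr_fun (mul_zpow_of_involutions' hx hy i) c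
  have hxx : ∀ c, x (x c) = c := fun c => Equiv.congr_fun hx c
  have hyy : ∀ c, y (y c) = c := fun c => Equiv.congr_fun hy c
  have hadd : ∀ (i j : ℤ) (c : α), ((x * y) ^ i) (((x * y) ^ j) c) = ((x * y) ^ (i + j)) c :=
    fun i j c => by rw [zpow_add]; rfl
  have hyb : y b = ((x * y) ^ (-1 : ℤ)) (x b) := by
    rw [← key]
    simp [hxx]
  have hyxb : y (x b) = ((x * y) ^ (-1 : ℤ)) b := by
    have := key' 1 (y b)
    rw [hyy] at this
    rw [← this]
    simp [hyy]
  have hcross : ∀ i j : ℤ, ((x * y) ^ i) b ≠ ((x * y) ^ j) (x b) := by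
    intro i j h
    have h1 : x b = ((x * y) ^ (i - j)) b := by
      rw [sub_eq_neg_add, ← hadd, h, hadd]; simp
    obtain ⟨m, hm | hm⟩ := Int.even_or_odd' (j - i)
    · apply hbx _ ⟨-m, Or.inl rfl⟩
      rw [key, h1, hadd]
      congr 2
      linarith
    · apply hby _ ⟨-m - 1, Or.inl rfl⟩
      rw [key', hyb, h1, hadd, hadd]
      congr 2
      linarith
  let f : α → α := fun a =>
    if h : ∃ i : ℤ, a = ((x * y) ^ i) b then ((x * y) ^ (-h.choose)) b
    else if h : ∃ i : ℤ, a = ((x * y) ^ i) (x b) then ((x * y) ^ (-h.choose - 1)) (x b) else a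
  have hf₁ : ∀ i : ℤ, f (((x * y) ^ i) b) = ((x * y) ^ (-i)) b := by
    intro i
    have h : ∃ k : ℤ, ((x * y) ^ i) b = ((x * y) ^ k) b := ⟨i, rfl⟩
    simp only [f, dif_pos h]
    have := h.choose_spec
    have := congrArg ((x * y) ^ (-i - h.choose)) this
    rw [hadd, hadd] at this
    convert this using 3 <;> ring
  have hf₂ : ∀ i : ℤ, f (((x * y) ^ i) (x b)) = ((x * y) ^ (-i - 1)) (x b) := by
    intro i
    have h' : ¬ ∃ k : ℤ, ((x * y) ^ i) (x b) = ((x * y) ^ k) b := by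
      rintro ⟨k, hk⟩
      exact hcross k i hk.symm
    have h : ∃ k : ℤ, ((x * y) ^ i) (x b) = ((x * y) ^ k) (x b) := ⟨i, rfl⟩
    simp only [f, dif_neg h', dif_pos h]
    have := h.choose_spec
    have := congrArg ((x * y) ^ (-i - h.choose - 1)) this
    rw [hadd, hadd] at this
    convert this using 3 <;> ring
  refine ⟨f, ?_⟩
  rintro a ⟨i, rfl | rfl⟩
  · refine ⟨⟨-i, Or.inl (hf₁ i)⟩, by rw [hf₁, hf₁, neg_neg], ?_⟩
    rw [key, hf₂, hf₁, key', hyb, hadd]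
    congr 2
  · refine ⟨⟨-i - 1, Or.inr (hf₂ i)⟩, by rw [hf₂, hf₂]; congr 2; ring, ?_⟩
    rw [key, hxx, hf₁, hf₂, key', hyxb, hadd]
    congr 2
    ring

theorem exists_commuting_swap [Finite α] [DecidableEq α] {b : α} (hb : y b = b)
    (hbx : ∀ i : ℤ, x (((x * y) ^ i) b) ≠ ((x * y) ^ i) b) :
    ∃ z : Equiv.Perm α, z * x = x * z ∧ z * y = y * z ∧ (∀ a, x a = a → z a = a) ∧
      ∃ c d, c ≠ d ∧ (∀ a, y a = a → Equiv.swap c d a = z a) ∧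
        ∀ a, y a ≠ a → Equiv.swap c d a = a := by
  classical
  have key : ∀ (i : ℤ) (c : α), x (((x * y) ^ i) c) = ((x * y) ^ (-i)) (x c) := fun i c =>
    Equiv.congr_fun (mul_zpow_of_involutions hx hy i) c
  have key' : ∀ (i : ℤ) (c : α), y (((x * y) ^ i) c) = ((x * y) ^ (-i)) (y c) := fun i c =>
    Equiv.congr_fun (mul_zpow_of_involutions' hx hy i) c
  have hxx : ∀ c, x (x c) = c := fun c => Equiv.congr_fun hx c
  have hyy : ∀ c, y (y c) = c := fun c => Equiv.congr_fun hy c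
  have hadd : ∀ (i j : ℤ) (c : α), ((x * y) ^ i) (((x * y) ^ j) c) = ((x * y) ^ (i + j)) c :=
    fun i j c => by rw [zpow_add]; rfl
  have hxb : x b = ((x * y) ^ (1 : ℤ)) b := by simp [hb]
  have hdvd : ∀ i j : ℤ, ((x * y) ^ i) b = ((x * y) ^ j) b ↔
      (Function.minimalPeriod ((x * y) • ·) b : ℤ) ∣ i - j := by
    intro i j
    rw [← MulAction.zpow_smul_eq_iff_minimalPeriod_dvd, Equiv.Perm.smul_def, sub_eq_neg_add,
      ← hadd]
    rw [zpow_neg, Equiv.Perm.inv_eq_iff_eq]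
  set v := Function.minimalPeriod ((x * y) • ·) b with hv
  have hv0 : v ≠ 0 := (MulAction.minimalPeriod_pos (x * y) b).out
  obtain ⟨l, hl⟩ : ∃ l : ℕ, v = 2 * l := by
    obtain ⟨l, hl | hl⟩ := Nat.even_or_odd' v
    · exact ⟨l, hl⟩
    · exfalso
      apply hbx (l + 1)
      rw [key, hxb, hadd, hdvd, hl]
      exact ⟨-1, by push_cast; ring⟩
  have h2l : ∀ i : ℤ, ((x * y) ^ (l + (l + i) : ℤ)) b = ((x * y) ^ i) b := by
    intro i
    rw [hdvd, hl]
    exact ⟨1, by push_cast; ring⟩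
  have hneg : ∀ i : ℤ, ((x * y) ^ (-l + i : ℤ)) b = ((x * y) ^ (l + i : ℤ)) b := by
    intro i
    rw [hdvd, hl]
    exact ⟨-1, by push_cast; ring⟩
  let O : α → Prop := fun a => ∃ i : ℤ, a = ((x * y) ^ i) b
  let f : α → α := fun a => if O a then ((x * y) ^ (l : ℤ)) a else a
  have hfO : ∀ i : ℤ, f (((x * y) ^ i) b) = ((x * y) ^ (l + i : ℤ)) b := by
    intro i
    have : O (((x * y) ^ i) b) := ⟨i, rfl⟩
    simp only [f, if_pos this, hadd]
  have hfn : ∀ a, ¬ O a → f a = a := fun a ha => if_neg ha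
  have hff : Function.Involutive f := by
    intro a
    by_cases ha : O a
    · obtain ⟨i, rfl⟩ := ha
      rw [hfO, hfO, h2l]
    · rw [hfn a ha, hfn a ha]
  have hxO : ∀ a, O a → O (x a) := by
    rintro a ⟨i, rfl⟩
    exact ⟨-i + 1, by rw [key, hxb, hadd]⟩
  have hyO : ∀ a, O a → O (y a) := by
    rintro a ⟨i, rfl⟩
    exact ⟨-i, by rw [key', hb]⟩
  refine ⟨hff.toPerm, Equiv.ext fun a => ?_, Equiv.ext fun a => ?_, fun a ha => ?_, b,
    ((x * y) ^ (l : ℤ)) b, ?_, fun a ha => ?_, fun a ha => ?_⟩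
  · change f (x a) = x (f a)
    by_cases ha : O a
    · obtain ⟨i, rfl⟩ := ha
      rw [hfO, key, key, hxb, hadd, hadd, hfO, neg_add, add_assoc, hneg]
    · rw [hfn a ha, hfn]
      exact fun h => ha (by simpa [hxx] using hxO _ h)
  · change f (y a) = y (f a)
    by_cases ha : O a
    · obtain ⟨i, rfl⟩ := ha
      rw [hfO, key', key', hb, hfO, neg_add, hneg]
    · rw [hfn a ha, hfn]
      exact fun h => ha (by simpa [hyy] using hyO _ h)
  · refine hfn a ?_
    rintro ⟨i, rfl⟩
    exact hbx i ha
  · intro h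
    have := (hdvd 0 l).1 (by simpa using h)
    rw [hl] at this
    obtain ⟨c, hc⟩ := this
    push_cast at hc
    have hl0 : (l : ℤ) ≠ 0 := by lia
    have : (l : ℤ) * (2 * c + 1) = 0 := by linarith
    rcases mul_eq_zero.1 this with h | h
    · exact hl0 h
    · lia
  · change _ = f a
    by_cases hO : O a
    · obtain ⟨i, rfl⟩ := hO
      rw [key', hb, hdvd, hl] at ha
      obtain ⟨c, hc⟩ := ha
      push_cast at hc
      have hi : i = -l * c := by linarith
      obtain ⟨m, hm | hm⟩ := Int.even_or_odd' c
      · have : ((x * y) ^ i) b = b := by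
          have := (hdvd i 0).2 (by rw [hl, hi, hm]; exact ⟨-m, by push_cast; ring⟩)
          simpa using this
        rw [hfO, ← hadd, this, Equiv.swap_apply_left]
      · have : ((x * y) ^ i) b = ((x * y) ^ (l : ℤ)) b := by
          rw [hdvd, hl, hi, hm]
          exact ⟨-m - 1, by push_cast; ring⟩
        rw [hfO, ← hadd, this, Equiv.swap_apply_right]
        have := h2l 0
        rw [add_zero, ← hadd] at this
        simpa using this.symm
    · rw [hfn a hO, Equiv.swap_apply_of_ne_of_ne]
      · rintro rfl
        exact hO ⟨0, by simp⟩
      · rintro rfl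
        exact hO ⟨l, rfl⟩
  · rw [Equiv.swap_apply_of_ne_of_ne]
    · rintro rfl
      exact ha hb
    · rintro rfl
      apply ha
      rw [key', hb, hdvd, hl]
      exact ⟨-1, by push_cast; ring⟩

omit hx hy in
/-- The orbit dichotomy for two involutions `x` and `y`: either they are swapped by an involution,
or some permutation commutes with both and acts as the identity on the fixed points of one and
as a transposition on the fixed points of the other. -/
theorem exists_involution_or_exists_commuting [Finite α] [DecidableEq α]
    (hx : x * x = 1) (hy : y * y = 1) :
    (∃ t : Equiv.Perm α, t * t = 1 ∧ t * x = y * t) ∨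
    ∃ z : Equiv.Perm α, z * x = x * z ∧ z * y = y * z ∧
      (((∀ a, x a = a → z a = a) ∧ ∃ c d, c ≠ d ∧ (∀ a, y a = a → Equiv.swap c d a = z a) ∧
        ∀ a, y a ≠ a → Equiv.swap c d a = a) ∨
      ((∀ a, y a = a → z a = a) ∧ ∃ c d, c ≠ d ∧ (∀ a, x a = a → Equiv.swap c d a = z a) ∧
        ∀ a, x a ≠ a → Equiv.swap c d a = a)) := by
  have key' : ∀ (i : ℤ) (c : α), y (((x * y) ^ i) c) = ((x * y) ^ (-i)) (y c) := fun i c =>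
    Equiv.congr_fun (mul_zpow_of_involutions' hx hy i) c
  have hyx : ∀ i : ℤ, (y * x) ^ i = (x * y) ^ (-i) := by
    intro i
    rw [zpow_neg, ← inv_zpow, mul_inv_rev, inv_eq_of_mul_eq_one_left hx,
      inv_eq_of_mul_eq_one_left hy]
  let s := dihedralSetoid x y hx hy
  by_cases h₁ : ∃ b, y b = b ∧ ∀ i : ℤ, x (((x * y) ^ i) b) ≠ ((x * y) ^ i) b
  · obtain ⟨b, hb, hbx⟩ := h₁
    obtain ⟨z, h1, h2, h3⟩ := exists_commuting_swap hx hy hb hbx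
    exact Or.inr ⟨z, h1, h2, Or.inl h3⟩
  by_cases h₂ : ∃ b, x b = b ∧ ∀ i : ℤ, y (((y * x) ^ i) b) ≠ ((y * x) ^ i) b
  · obtain ⟨b, hb, hbx⟩ := h₂
    obtain ⟨z, h1, h2, h3⟩ := exists_commuting_swap hy hx hb hbx
    exact Or.inr ⟨z, h2, h1, Or.inr h3⟩
  push Not at h₁ h₂
  left
  refine exists_involution_of_forall_orbit s (fun a => ⟨0, Or.inr (by simp)⟩) fun b => ?_
  have htransfer : ∀ c, s c b → y c = c → ∃ f : α → α, ∀ a, s a b →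
      s (f a) b ∧ f (f a) = a ∧ f (x a) = y (f a) := by
    intro c hcb hc
    obtain ⟨j, hj⟩ := h₁ c hc
    obtain ⟨f, hf⟩ := exists_local_involution_of_fixed hx hy hc hj
    exact ⟨f, fun a ha => ⟨s.trans (hf a (s.trans ha (s.symm hcb))).1 hcb,
      (hf a (s.trans ha (s.symm hcb))).2⟩⟩
  by_cases hY : ∃ c, s c b ∧ y c = c
  · obtain ⟨c, hcb, hc⟩ := hY
    exact htransfer c hcb hc
  by_cases hX : ∃ c, s c b ∧ x c = c
  · obtain ⟨c, hcb, hc⟩ := hX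
    obtain ⟨j, hj⟩ := h₂ c hc
    rw [hyx] at hj
    exact absurd ⟨_, s.trans ⟨-j, Or.inl rfl⟩ hcb, hj⟩ hY
  push Not at hX hY
  exact exists_local_involution_of_not_fixed hx hy hX hY

end Involutions

section SmallCycles

variable {α : Type*} [DecidableEq α]

theorem exists_involution_mul_swap {a b c d : α} (hab : a ≠ b) (hcd : c ≠ d) :
    ∃ t : Equiv.Perm α, t * t = 1 ∧ t * Equiv.swap a b = Equiv.swap c d * t := by
  have key : ∀ t : Equiv.Perm α, t * t = 1 → (t a = c ∧ t b = d ∨ t a = d ∧ t b = c) →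
      ∃ t : Equiv.Perm α, t * t = 1 ∧ t * Equiv.swap a b = Equiv.swap c d * t := by
    rintro t ht (⟨h1, h2⟩ | ⟨h1, h2⟩)
    · exact ⟨t, ht, by rw [Equiv.mul_swap_eq_swap_mul, h1, h2]⟩
    · exact ⟨t, ht, by rw [Equiv.mul_swap_eq_swap_mul, h1, h2, Equiv.swap_comm]⟩
  by_cases hac : a = c
  · exact key (Equiv.swap b d) (Equiv.swap_mul_self _ _) (by grind)
  by_cases had : a = d
  · exact key (Equiv.swap b c) (Equiv.swap_mul_self _ _) (by grind)
  by_cases hbc : b = c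
  · exact key (Equiv.swap a d) (Equiv.swap_mul_self _ _) (by grind)
  by_cases hbd : b = d
  · exact key (Equiv.swap a c) (Equiv.swap_mul_self _ _) (by grind)
  refine key (Equiv.swap a c * Equiv.swap b d) (Equiv.ext fun p => ?_) ?_
  · simp only [Equiv.Perm.mul_apply, Equiv.Perm.one_apply]
    grind
  · simp only [Equiv.Perm.mul_apply]
    grind

theorem exists_involution_map_triple_of_eq {a b c d e : α} (hab : a ≠ b) (hbc : b ≠ c)
    (hac : a ≠ c) (hde : d ≠ e) (hec : e ≠ c) (hdc : d ≠ c) :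
    ∃ t : Equiv.Perm α, t * t = 1 ∧ (t a = d ∧ t b = e ∧ t c = c ∨ t a = e ∧ t b = c ∧ t c = d ∨
      t a = c ∧ t b = d ∧ t c = e) := by
  by_cases hae : a = e
  · by_cases hbd : b = d
    · exact ⟨Equiv.swap a b, Equiv.swap_mul_self _ _, by grind⟩
    · refine ⟨Equiv.swap a c * Equiv.swap b d, Equiv.ext fun p => ?_, ?_⟩ <;>
      simp only [Equiv.Perm.mul_apply, Equiv.Perm.one_apply] <;>
      grind
  · by_cases hbd : b = d
    · refine ⟨Equiv.swap b c * Equiv.swap a e, Equiv.ext fun p => ?_, ?_⟩ <;>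
      simp only [Equiv.Perm.mul_apply, Equiv.Perm.one_apply] <;>
      grind
    · refine ⟨Equiv.swap a d * Equiv.swap b e, Equiv.ext fun p => ?_, ?_⟩ <;>
      simp only [Equiv.Perm.mul_apply, Equiv.Perm.one_apply] <;>
      grind

theorem exists_involution_map_triple {a b c d e f : α} (hab : a ≠ b) (hbc : b ≠ c)
    (hac : a ≠ c) (hde : d ≠ e) (hef : e ≠ f) (hdf : d ≠ f) :
    ∃ t : Equiv.Perm α, t * t = 1 ∧ (t a = d ∧ t b = e ∧ t c = f ∨ t a = e ∧ t b = f ∧ t c = d ∨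
      t a = f ∧ t b = d ∧ t c = e) := by
  have key : ∀ a b c d e f : α, a ≠ b → b ≠ c → a ≠ c → d ≠ e → e ≠ f → d ≠ f →
      (c = f ∨ c = d ∨ c = e) → ∃ t : Equiv.Perm α, t * t = 1 ∧
      (t a = d ∧ t b = e ∧ t c = f ∨ t a = e ∧ t b = f ∧ t c = d ∨
        t a = f ∧ t b = d ∧ t c = e) := by
    rintro a b c d e f hab hbc hac hde hef hdf (rfl | rfl | rfl)
    · exact exists_involution_map_triple_of_eq hab hbc hac hde hef hdf
    · obtain ⟨t, ht, h⟩ := exists_involution_map_triple_of_eq hab hbc hac hef hdf.symm hde.symm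
      exact ⟨t, ht, by tauto⟩
    · obtain ⟨t, ht, h⟩ := exists_involution_map_triple_of_eq hab hbc hac hdf.symm hde hef.symm
      exact ⟨t, ht, by tauto⟩
  by_cases h₁ : c = f ∨ c = d ∨ c = e
  · exact key a b c d e f hab hbc hac hde hef hdf h₁
  by_cases h₂ : b = f ∨ b = d ∨ b = e
  · obtain ⟨t, ht, h⟩ := key c a b d e f hac.symm hab hbc.symm hde hef hdf h₂
    exact ⟨t, ht, by tauto⟩
  by_cases h₃ : a = f ∨ a = d ∨ a = e
  · obtain ⟨t, ht, h⟩ := key b c a d e f hbc hac.symm hab.symm hde hef hdf h₃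
    exact ⟨t, ht, by tauto⟩
  refine ⟨Equiv.swap a d * Equiv.swap b e * Equiv.swap c f, Equiv.ext fun p => ?_, Or.inl ?_⟩ <;>
  simp only [Equiv.Perm.mul_apply, Equiv.Perm.one_apply] <;>
  grind (splits := 20)

theorem exists_involution_mul_threeCycle {x y : Equiv.Perm α} {a d : α}
    (hab : x a ≠ a) (hac : x (x a) ≠ a) (hx : x (x (x a)) = a)
    (hx' : ∀ p, p ≠ a → p ≠ x a → p ≠ x (x a) → x p = p)
    (hde : y d ≠ d) (hdf : y (y d) ≠ d) (hy : y (y (y d)) = d)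
    (hy' : ∀ p, p ≠ d → p ≠ y d → p ≠ y (y d) → y p = p) :
    ∃ t : Equiv.Perm α, t * t = 1 ∧ t * x = y * t := by
  obtain ⟨t, ht, h⟩ := exists_involution_map_triple hab.symm
    (fun h => hab (x.injective h).symm) hac.symm hde.symm
    (fun h => hde (y.injective h).symm) hdf.symm
  refine ⟨t, ht, Equiv.ext fun p => ?_⟩
  have htt : ∀ p, t (t p) = p := fun p => Equiv.congr_fun ht p
  simp only [Equiv.Perm.mul_apply]
  by_cases h1 : p = a
  · grind
  by_cases h2 : p = x a
  · grind
  by_cases h3 : p = x (x a)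
  · grind
  rw [hx' p h1 h2 h3, hy' (t p)] <;> grind

end SmallCycles

section Obstructions

variable {α : Type*} [DecidableEq α]

/-- A permutation `x` with a cycle of length at least four is conjugate to some `y` such that
no permutation interchanges `x` and `y` by conjugation, while the fixed-point sets of `x` and `y`
differ by at most one point on either side. -/
theorem exists_conj_of_long_cycle [Fintype α] (hα : 7 ≤ Fintype.card α) {x : Equiv.Perm α} {a : α}
    (h1 : x a ≠ a) (h2 : x (x a) ≠ a) (h3 : x (x (x a)) ≠ a) :
    ∃ τ y : Equiv.Perm α, τ * x = y * τ ∧ (∀ g, g * x = y * g → g * y ≠ x * g) ∧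
      (∃ c, ∀ i, x i = i → y i ≠ i → i = c) ∧ ∃ c, ∀ i, y i = i → x i ≠ i → i = c := by
  obtain ⟨p, hp⟩ := x.surjective a
  obtain ⟨p', hp'⟩ := x.surjective p
  obtain ⟨c, hc⟩ : ∃ c, c ∉ ({p', p, a, x a, x (x a), x (x (x a))} : Finset α) := by
    by_contra! h
    have := Finset.eq_univ_of_forall h
    have hle := Finset.card_le_six (a := p') (b := p) (c := a) (d := x a) (e := x (x a))
      (f := x (x (x a)))
    rw [this, Finset.card_univ] at hle
    lia
  simp only [Finset.mem_insert, Finset.mem_singleton, not_or] at hc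
  obtain ⟨hcp', hcp, hca, hcb, hcd, hce⟩ := hc
  obtain ⟨m, hm⟩ := x.surjective c
  have hinj : ∀ u v, x u = x v → u = v := fun u v h => x.injective h
  let τ : Equiv.Perm α := Equiv.swap a (x a) * Equiv.swap (x a) c
  let y : Equiv.Perm α := τ * x * τ⁻¹
  have hy : ∀ u, y (τ u) = τ (x u) := fun u => by simp [y]
  have hτ : ∀ u, τ u = if u = a then x a else if u = x a then c else if u = c then a else u := by
    intro u
    simp only [τ, Equiv.Perm.mul_apply]
    grind
  have y1 : y p = x a := by grind
  have y2 : y (x a) = c := by grind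
  have y3 : y c = x (x a) := by grind
  have y4 : x c ≠ c → y a = x c := by grind
  have y4' : x c = c → y a = a := by grind
  have y5 : x c ≠ c → y m = a := by grind
  have y6 : ∀ u, u ≠ p → u ≠ a → u ≠ x a → u ≠ c → u ≠ m → y u = x u := by grind
  refine ⟨τ, y, by simp [y], fun g hg hg' => ?_, ⟨c, ?_⟩, ⟨a, ?_⟩⟩
  · have e1 : ∀ u, g (x u) = y (g u) := fun u => Equiv.congr_fun hg u
    have e2 : ∀ u, g (y u) = x (g u) := fun u => Equiv.congr_fun hg' u
    have hD : ∀ u, x u ≠ y u → x (g u) ≠ y (g u) := by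
      intro u hu h
      rw [← e1, ← e2] at h
      exact hu (g.injective h).symm
    have k1 := hD p (by grind)
    have k2 := hD a (by grind)
    have k3 := hD (x a) (by grind)
    have r1 := e1 p
    rw [hp] at r1
    have r2 := e1 a
    have r3 := e2 p
    rw [y1] at r3
    grind
  · grind
  · grind

set_option maxHeartbeats 1000000 in
/-- The analogue of `exists_conj_of_long_cycle` for a permutation with a `3`-cycle, a further
nontrivial cycle, and a point outside both. -/
theorem exists_conj_of_three_cycle {x : Equiv.Perm α} {a b c : α}
    (h : ∀ u, x u = u ∨ x (x u) = u ∨ x (x (x u)) = u)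
    (h1 : x a ≠ a) (h2 : x (x a) ≠ a) (hb : x b ≠ b)
    (hba : b ≠ a ∧ b ≠ x a ∧ b ≠ x (x a)) (hca : c ≠ a ∧ c ≠ x a ∧ c ≠ x (x a))
    (hcb : c ≠ b ∧ c ≠ x b ∧ c ≠ x (x b)) :
    ∃ τ y : Equiv.Perm α, τ * x = y * τ ∧ (∀ g, g * x = y * g → g * y ≠ x * g) ∧
      (∃ c, ∀ i, x i = i → y i ≠ i → i = c) ∧ ∃ c, ∀ i, y i = i → x i ≠ i → i = c := by
  have hinj : ∀ u v, x u = x v → u = v := fun u v h => x.injective h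
  have ha3 : x (x (x a)) = a := by have := h a; grind
  let τ : Equiv.Perm α := Equiv.swap a (x b) * (Equiv.swap (x a) c * Equiv.swap c b)
  let y : Equiv.Perm α := τ * x * τ⁻¹
  have hy : ∀ u, y (τ u) = τ (x u) := fun u => by simp [y]
  have hτ : ∀ u, τ u = if u = a then x b else if u = x b then a else if u = x a then c else
      if u = c then b else if u = b then x a else u := by
    intro u
    simp only [τ, Equiv.Perm.mul_apply]
    grind
  have y1 : y (x b) = c := by grind
  have y2 : y c = x (x a) := by grind
  have y3 : y (x (x a)) = x b := by grind
  have y4 : y (x a) = a := by grind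
  have y5 : x (x b) = b → y a = x a := by grind
  have y6 : x (x b) ≠ b → y a = x (x b) := by grind
  have y7 : x (x b) ≠ b → y (x (x b)) = x a := by grind
  have y8 : x c = c → y b = b := by grind
  have y9 : x c ≠ c → y b = x c := by grind
  have y10 : x c ≠ c → x (x c) = c → y (x c) = b := by grind
  have y11 : x (x c) ≠ c → y (x (x c)) = b := by grind
  have y12 : x (x c) ≠ c → y (x c) = x (x c) := by grind
  have hout : ∀ u, u ≠ a → u ≠ x a → u ≠ x (x a) → u ≠ b → u ≠ x b → u ≠ x (x b) → u ≠ c →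
    u ≠ x c → u ≠ x (x c) → y u = x u := by grind
  have hxb := h b
  have hxc := h c
  have key : ∀ q, x q = y (y q) → x (x (y q)) = y (x (x q)) := by
    clear_value y
    clear hy hτ
    intro q hq
    rcases eq_or_ne q a with rfl | q1
    · by_cases hbb : x (x b) = b
      · rw [y5 hbb, y4] at hq
        exact absurd hq h1
      · rw [y6 hbb, y3]
        rcases hxb with e | e | e
        · exact absurd e hb
        · exact absurd e hbb
        · rw [e]
    rcases eq_or_ne q (x a) with rfl | q2
    · rw [y4] at hq
      by_cases hbb : x (x b) = b
      · rw [y5 hbb] at hq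
        exact absurd (hinj _ _ hq) h1
      · rw [y6 hbb] at hq
        exact absurd (hinj _ _ (hinj _ _ hq)).symm hba.1
    rcases eq_or_ne q (x (x a)) with rfl | q3
    · rw [y3, y1, ha3] at hq
      exact absurd hq.symm hca.1
    rcases eq_or_ne q b with rfl | q4
    · by_cases hcc : x c = c
      · rw [y8 hcc, y8 hcc] at hq
        exact absurd hq hb
      · rw [y9 hcc] at hq
        by_cases hcc' : x (x c) = c
        · rw [y10 hcc hcc'] at hq
          exact absurd hq hb
        · rw [y12 hcc'] at hq
          grind only
    rcases eq_or_ne q (x b) with rfl | q5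
    · rw [y1, y2] at hq
      exact absurd (hinj _ _ (hinj _ _ hq)) hba.1
    rcases eq_or_ne q (x (x b)) with rfl | q6
    · grind only
    rcases eq_or_ne q c with rfl | q7
    · rw [y2, y3] at hq
      exact absurd (hinj _ _ hq) hcb.1
    rcases eq_or_ne q (x c) with rfl | q8
    · by_cases hcc' : x (x c) = c
      · rw [y10 q7 hcc', y9 q7, hcc'] at hq
        exact absurd hq.symm q7
      · rw [y12 hcc', y11 hcc'] at hq
        grind only
    rcases eq_or_ne q (x (x c)) with rfl | q9
    · grind only
    have hxq := h q
    have f1 := hout q q1 q2 q3 q4 q5 q6 q7 q8 q9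
    have f2 : y (x q) = x (x q) := by
      have hne : ∀ u, q ≠ u → q ≠ x u → q ≠ x (x u) → x q ≠ u ∧ x q ≠ x u ∧ x q ≠ x (x u) := by
        intro u v1 v2 v3
        have := h u
        grind only
      obtain ⟨v1, v2, v3⟩ := hne a q1 q2 q3
      obtain ⟨v4, v5, v6⟩ := hne b q4 q5 q6
      obtain ⟨v7, v8, v9⟩ := hne c q7 q8 q9
      exact hout _ v1 v2 v3 v4 v5 v6 v7 v8 v9
    rw [f1, f2] at hq
    rw [f1, ← hinj _ _ hq, ← hinj _ _ hq, f1]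
  refine ⟨τ, y, by simp [y], fun g hg hg' => ?_, ⟨c, ?_⟩, ⟨b, ?_⟩⟩
  · have e1 : ∀ u, g (x u) = y (g u) := fun u => Equiv.congr_fun hg u
    have e2 : ∀ u, g (y u) = x (g u) := fun u => Equiv.congr_fun hg' u
    have k := key (g (x a)) (by rw [← e1, ← e1, ← e2, y4, ha3])
    rw [← e1, ← e2, ← e2, ← e2, ← e2, ← e1] at k
    have := g.injective k
    grind
  · grind
  · intro i hi hxi
    by_contra hib
    clear key hinj hy hτ
    clear_value y
    have i1 : i ≠ a := by rintro rfl; grind only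
    have i2 : i ≠ x a := by rintro rfl; grind only
    have i3 : i ≠ x (x a) := by rintro rfl; grind only
    have i5 : i ≠ x b := by rintro rfl; grind only
    have i6 : i ≠ x (x b) := by rintro rfl; grind only
    have i7 : i ≠ c := by rintro rfl; grind only
    have i8 : i ≠ x c := by rintro rfl; grind only
    have i9 : i ≠ x (x c) := by rintro rfl; grind only
    exact hxi (hout i i1 i2 i3 hib i5 i6 i7 i8 i9 ▸ hi)

set_option maxHeartbeats 1000000 in
/-- An involution with at least two transpositions and two fixed points is conjugate to some `y`
such that no permutation interchanges `x` and `y` by conjugation. -/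
theorem exists_conj_of_involution {x : Equiv.Perm α} (hx : ∀ u, x (x u) = u) {a c p q : α}
    (ha : x a ≠ a) (hc : x c ≠ c) (hca : c ≠ a) (hcb : c ≠ x a) (hp : x p = p) (hq : x q = q)
    (hpq : p ≠ q) :
    ∃ τ y : Equiv.Perm α, τ * x = y * τ ∧ ∀ g, g * x = y * g → g * y ≠ x * g := by
  have hinj : ∀ u v, x u = x v → u = v := fun u v h => x.injective h
  let τ : Equiv.Perm α := Equiv.swap a (x a) * Equiv.swap (x a) c * Equiv.swap c p *
    Equiv.swap (x c) q
  let y : Equiv.Perm α := τ * x * τ⁻¹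
  have hy : ∀ u, y (τ u) = τ (x u) := fun u => by simp [y]
  have hτ : ∀ u, τ u = if u = a then x a else if u = x a then c else if u = c then p else
      if u = p then a else if u = x c then q else if u = q then x c else u := by
    intro u
    have hcx : x c ≠ x a ∧ x c ≠ a ∧ x c ≠ p ∧ x c ≠ q ∧ a ≠ p ∧ a ≠ q ∧ c ≠ p ∧ c ≠ q ∧
        x a ≠ p ∧ x a ≠ q := by grind
    simp only [τ, Equiv.Perm.mul_apply, Equiv.swap_apply_def]
    grind only
  have y1 : y (x a) = c := by grind
  have y2 : y c = x a := by grind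
  have y3 : y a = a := by grind
  have y4 : y (x c) = x c := by grind
  have hout : ∀ u, u ≠ a → u ≠ x a → u ≠ c → u ≠ x c → u ≠ p → u ≠ q → y u = x u := by grind
  refine ⟨τ, y, by simp [y], fun g hg hg' => ?_⟩
  have e1 : ∀ u, g (x u) = y (g u) := fun u => Equiv.congr_fun hg u
  have e2 : ∀ u, g (y u) = x (g u) := fun u => Equiv.congr_fun hg' u
  have hP : ∀ u, x u ≠ u → y u ≠ u → x u ≠ y u →
      x (g u) ≠ g u ∧ y (g u) ≠ g u ∧ x (g u) ≠ y (g u) := by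
    intro u h1 h2 h3
    rw [← e1, ← e2, Ne, Ne, Ne, g.injective.eq_iff, g.injective.eq_iff, g.injective.eq_iff]
    exact ⟨h2, h1, h3.symm⟩
  have k1 := hP (x a) (by grind) (by grind) (by grind)
  have k2 := hP c (by grind) (by grind) (by grind)
  have k3 := e2 (x a)
  rw [y1] at k3
  grind

end Obstructions

section RestrictFixed

variable {n : ℕ} {x : Equiv.Perm (Fin n)}

theorem restrictFixed_apply_coe (h : Subgroup.centralizer ({x} : Set (Equiv.Perm (Fin n))))
    (i : {i : Fin n // x i = i}) : (restrictFixed x h i : Fin n) = (h : Equiv.Perm (Fin n)) i :=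
  rfl

/-- Restriction to the fixed points of `x`, as a homomorphism on the centralizer of `x`. -/
def restrictFixedHom (x : Equiv.Perm (Fin n)) :
    Subgroup.centralizer ({x} : Set (Equiv.Perm (Fin n))) →* Equiv.Perm {i : Fin n // x i = i} where
  toFun := restrictFixed x
  map_one' := rfl
  map_mul' _ _ := rfl

theorem mem_centralizer_of_mul_eq {h : Equiv.Perm (Fin n)} (e : h * x = x * h) :
    h ∈ Subgroup.centralizer ({x} : Set (Equiv.Perm (Fin n))) :=
  Subgroup.mem_centralizer_iff.mpr fun _ hy => by rw [Set.mem_singleton_iff.mp hy, e]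

theorem coe_mul_eq (h : Subgroup.centralizer ({x} : Set (Equiv.Perm (Fin n)))) :
    (h : Equiv.Perm (Fin n)) * x = x * h :=
  (Subgroup.mem_centralizer_iff.mp h.2 x rfl).symm

/-- The sign of the restriction of `h` to the fixed points of `x` may be computed from any
permutation `P` that agrees with `h` there and is trivial elsewhere. -/
theorem sign_restrictFixed_eq (h : Subgroup.centralizer ({x} : Set (Equiv.Perm (Fin n))))
    {P : Equiv.Perm (Fin n)} (h1 : ∀ i, x i = i → P i = (h : Equiv.Perm (Fin n)) i)
    (h2 : ∀ i, x i ≠ i → P i = i) : Equiv.Perm.sign (restrictFixed x h) = Equiv.Perm.sign P := by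
  rw [← Equiv.Perm.sign_ofSubtype]
  congr 1
  ext1 i
  by_cases hi : x i = i
  · rw [Equiv.Perm.ofSubtype_apply_of_mem (restrictFixed x h) hi, h1 i hi, restrictFixed_apply_coe]
  · rw [Equiv.Perm.ofSubtype_apply_of_not_mem (restrictFixed x h) hi, h2 i hi]

/-- A version of `sign_restrictFixed_eq` transported along a conjugation of `x` to `y`. -/
theorem sign_restrictFixed_eq_of_conj
    (h : Subgroup.centralizer ({x} : Set (Equiv.Perm (Fin n)))) {g y z P : Equiv.Perm (Fin n)}
    (hx : g * x = y * g) (hz : g * h = z * g) (h1 : ∀ i, y i = i → P i = z i)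
    (h2 : ∀ i, y i ≠ i → P i = i) : Equiv.Perm.sign (restrictFixed x h) = Equiv.Perm.sign P := by
  have ex : ∀ i, g (x i) = y (g i) := fun i => Equiv.congr_fun hx i
  have ez : ∀ i, g ((h : Equiv.Perm (Fin n)) i) = z (g i) := fun i => Equiv.congr_fun hz i
  rw [sign_restrictFixed_eq h (P := g⁻¹ * P * g)]
  · rw [map_mul, map_mul, Equiv.Perm.sign_inv, mul_right_comm, Int.units_mul_self, one_mul]
  · intro i hi
    rw [Equiv.Perm.mul_apply, Equiv.Perm.mul_apply, h1 _ (by rw [← ex, hi]), ← ez,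
      ← Equiv.Perm.mul_apply, inv_mul_cancel, Equiv.Perm.one_apply]
  · intro i hi
    rw [Equiv.Perm.mul_apply, Equiv.Perm.mul_apply,
      h2 _ (by rwa [← ex, Ne, g.injective.eq_iff]), ← Equiv.Perm.mul_apply,
      inv_mul_cancel, Equiv.Perm.one_apply]

theorem signComplex_mul_eq_one_iff {α : Type*} [Fintype α] [DecidableEq α]
    (p q : Equiv.Perm α) :
    signComplex α p * signComplex α q = 1 ↔ Equiv.Perm.sign p * Equiv.Perm.sign q = 1 := by
  rw [← map_mul, ← map_mul]
  constructor
  · intro h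
    rcases Int.units_eq_one_or (Equiv.Perm.sign (p * q)) with e | e
    · exact e
    · have := congrArg Units.val h
      simp only [signComplex, MonoidHom.comp_apply, e] at this
      norm_num at this
  · intro h
    simp [signComplex, MonoidHom.comp_apply, h, -map_mul]

theorem mul_self_eq_one_of_trivial_or_sign {α : Type*} [Fintype α] [DecidableEq α]
    {θ : Equiv.Perm α →* ℂˣ} (hθ : θ = 1 ∨ θ = signComplex α) (p : Equiv.Perm α) :
    θ p * θ p = 1 := by
  rcases hθ with rfl | rfl
  · simp
  · rw [signComplex_mul_eq_one_iff]
    exact Int.units_mul_self _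

/-- Gelfand's criterion for the character of the centralizer of `x` obtained from `θ`, in terms of
pairs of conjugates of `x`. -/
theorem isMultFreeRel_restrictFixed_of_forall_exists {θ : Equiv.Perm {i : Fin n // x i = i} →* ℂˣ}
    (hθ : θ = 1 ∨ θ = signComplex _)
    (H : ∀ y g : Equiv.Perm (Fin n), g * x = y * g → (∃ t, t * t = 1 ∧ t * x = y * t) ∨
      (θ = signComplex _ ∧ ∃ z, z * x = x * z ∧ z * y = y * z ∧
        (((∀ a, x a = a → z a = a) ∧ ∃ c d, c ≠ d ∧ (∀ a, y a = a → Equiv.swap c d a = z a) ∧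
            ∀ a, y a ≠ a → Equiv.swap c d a = a) ∨
          ((∀ a, y a = a → z a = a) ∧ ∃ c d, c ≠ d ∧ (∀ a, x a = a → Equiv.swap c d a = z a) ∧
            ∀ a, x a ≠ a → Equiv.swap c d a = a)))) :
    IsMultFreeRel (Subgroup.centralizer ({x} : Set (Equiv.Perm (Fin n))))
      (fun g => (θ (restrictFixed x g) : ℂ)) := by
  refine isMultFreeRel_of_forall_exists (θ.comp (restrictFixedHom x))
    (fun h => mul_self_eq_one_of_trivial_or_sign hθ _) fun g => ?_
  rcases H (g * x * g⁻¹) g (by group) with ⟨t, ht, htx⟩ | ⟨rfl, z, hzx, hzy, hz⟩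
  · left
    have hm : g⁻¹ * t * x = x * (g⁻¹ * t) := by
      rw [mul_assoc, htx]
      group
    refine ⟨⟨g⁻¹ * t, mem_centralizer_of_mul_eq hm⟩, ⟨g⁻¹ * t, mem_centralizer_of_mul_eq hm⟩, ?_,
      mul_self_eq_one_of_trivial_or_sign hθ _⟩
    calc g⁻¹ * t * g * (g⁻¹ * t) = g⁻¹ * (t * t) := by group
      _ = g⁻¹ := by rw [ht, mul_one]
  · right
    have hzy' : z⁻¹ * (g * x * g⁻¹) = g * x * g⁻¹ * z⁻¹ := by
      rw [inv_mul_eq_iff_eq_mul, ← mul_assoc, hzy, mul_inv_cancel_right]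
    have hm : g⁻¹ * z⁻¹ * g * x = x * (g⁻¹ * z⁻¹ * g) :=
      calc g⁻¹ * z⁻¹ * g * x = g⁻¹ * (z⁻¹ * (g * x * g⁻¹)) * g := by group
        _ = x * (g⁻¹ * z⁻¹ * g) := by rw [hzy']; group
    have hm' : g⁻¹ * z * g * x = x * (g⁻¹ * z * g) :=
      calc g⁻¹ * z * g * x = g⁻¹ * (z * (g * x * g⁻¹)) * g := by group
        _ = x * (g⁻¹ * z * g) := by rw [hzy]; group
    set h₁ : Subgroup.centralizer ({x} : Set (Equiv.Perm (Fin n))) :=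
      ⟨z, mem_centralizer_of_mul_eq hzx⟩ with hh₁
    set h₂ : Subgroup.centralizer ({x} : Set (Equiv.Perm (Fin n))) :=
      ⟨g⁻¹ * z * g, mem_centralizer_of_mul_eq hm'⟩ with hh₂
    have hxg : g * x = g * x * g⁻¹ * g := by group
    have hzg : g * (g⁻¹ * z * g) = z * g := by group
    refine ⟨h₁, h₂⁻¹, ?_, ?_⟩
    · simp only [hh₁, hh₂, InvMemClass.coe_inv]
      group
    · simp only [MonoidHom.comp_apply, map_inv]
      rw [← map_inv, Ne, signComplex_mul_eq_one_iff, Equiv.Perm.sign_inv]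
      change ¬ Equiv.Perm.sign (restrictFixed x h₁) * Equiv.Perm.sign (restrictFixed x h₂) = 1
      rcases hz with ⟨hf, c, d, hcd, hy1, hy2⟩ | ⟨hf, c, d, hcd, hx1, hx2⟩
      · rw [sign_restrictFixed_eq h₁ (P := 1) (fun i hi => (hf i hi).symm) fun _ _ => rfl,
          sign_restrictFixed_eq_of_conj h₂ hxg hzg hy1 hy2, Equiv.Perm.sign_swap hcd]
        simp
      · rw [sign_restrictFixed_eq h₁ hx1 hx2,
          sign_restrictFixed_eq_of_conj h₂ (P := 1) hxg hzg (fun i hi => (hf i hi).symm)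
            fun _ _ => rfl, Equiv.Perm.sign_swap hcd]
        simp

/-- A conjugate `y` of `x` that cannot be interchanged with `x` obstructs multiplicity-freeness, if
the `θ`-twisted double coset it defines does not vanish. -/
theorem not_isMultFreeRel_restrictFixed {θ : Equiv.Perm {i : Fin n // x i = i} →* ℂˣ}
    (hθ : θ = 1 ∨ θ = signComplex _) {g y : Equiv.Perm (Fin n)} (hg : g * x = y * g)
    (hN : ∀ g, g * x = y * g → g * y ≠ x * g)
    (hS : θ = 1 ∨ (∃ c, ∀ i, x i = i → y i ≠ i → i = c) ∧ ∃ c, ∀ i, y i = i → x i ≠ i → i = c) :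
    ¬ IsMultFreeRel (Subgroup.centralizer ({x} : Set (Equiv.Perm (Fin n))))
      (fun g => (θ (restrictFixed x g) : ℂ)) := by
  refine not_isMultFreeRel (θ.comp (restrictFixedHom x))
    (fun h => mul_self_eq_one_of_trivial_or_sign hθ _)
    (fun g => Equiv.Perm.isConj_iff_cycleType_eq.mpr (Equiv.Perm.cycleType_inv g).symm) g
    (fun h₁ h₂ h => ?_) fun h₁ h₂ h => ?_
  · rcases hθ with rfl | rfl
    · simp
    rcases hS with hS | ⟨⟨c, hc⟩, c', hc'⟩
    · rw [hS]
      simp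
    have e1 : ∀ i, (h₁ : Equiv.Perm (Fin n)) (x i) = x ((h₁ : Equiv.Perm (Fin n)) i) :=
      fun i => Equiv.congr_fun (coe_mul_eq h₁) i
    have hgz : g * ↑h₂⁻¹ = ↑h₁ * g := by
      rw [InvMemClass.coe_inv, mul_inv_eq_iff_eq_mul, h]
    have hyz : (h₁ : Equiv.Perm (Fin n)) * y = y * h₁ := by
      have ey : y = g * x * g⁻¹ := by rw [hg]; group
      have e2 : (h₁ : Equiv.Perm (Fin n)) = g * ↑h₂⁻¹ * g⁻¹ := by rw [hgz]; group
      have e3 := coe_mul_eq h₂⁻¹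
      calc (h₁ : Equiv.Perm (Fin n)) * y = g * (↑h₂⁻¹ * x) * g⁻¹ := by rw [e2, ey]; group
        _ = y * h₁ := by rw [e3, e2, ey]; group
    have e2 : ∀ i, (h₁ : Equiv.Perm (Fin n)) (y i) = y ((h₁ : Equiv.Perm (Fin n)) i) :=
      fun i => Equiv.congr_fun hyz i
    generalize hz : (h₁ : Equiv.Perm (Fin n)) = z at e1 e2 hgz
    have hxf : ∀ i, x (z i) = z i ↔ x i = i := fun i => by rw [← e1, z.injective.eq_iff]
    have hyf : ∀ i, y (z i) = z i ↔ y i = i := fun i => by rw [← e2, z.injective.eq_iff]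
    have hzc : ∀ i, x i = i → y i ≠ i → z i = i := fun i hx hy =>
      (hc _ ((hxf i).mpr hx) (mt (hyf i).mp hy)).trans (hc i hx hy).symm
    have hzc' : ∀ i, y i = i → x i ≠ i → z i = i := fun i hy hx =>
      (hc' _ ((hyf i).mpr hy) (mt (hxf i).mp hx)).trans (hc' i hy hx).symm
    set P := Equiv.Perm.ofSubtype (restrictFixed x h₁) with hP
    have p1 : ∀ i, x i = i → P i = z i := fun i hi => by
      rw [hP, Equiv.Perm.ofSubtype_apply_of_mem (restrictFixed x h₁) hi,
        restrictFixed_apply_coe, hz]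
    have p2 : ∀ i, x i ≠ i → P i = i := fun i hi =>
      Equiv.Perm.ofSubtype_apply_of_not_mem (restrictFixed x h₁) hi
    have s := sign_restrictFixed_eq_of_conj h₂⁻¹ hg hgz (P := P)
      (fun i hi => by
        by_cases hx : x i = i
        · exact p1 i hx
        · rw [p2 i hx, hzc' i hi hx])
      (fun i hi => by
        by_cases hx : x i = i
        · rw [p1 i hx, hzc i hx hi]
        · exact p2 i hx)
    rw [hP, Equiv.Perm.sign_ofSubtype] at s
    change signComplex _ (restrictFixed x h₁) * signComplex _ (restrictFixed x h₂) = 1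
    rw [signComplex_mul_eq_one_iff, ← s]
    change Equiv.Perm.sign (restrictFixedHom x h₂⁻¹) * Equiv.Perm.sign (restrictFixedHom x h₂) = 1
    rw [← map_mul, ← map_mul, inv_mul_cancel, map_one, map_one]
  · refine hN (g * h₁) ?_ ?_
    · rw [mul_assoc, coe_mul_eq, ← mul_assoc, hg, mul_assoc]
    · have e : g * h₁ * g = (↑h₂⁻¹ : Equiv.Perm (Fin n)) := by
        rw [InvMemClass.coe_inv, eq_inv_iff_mul_eq_one, mul_assoc, mul_assoc, ← mul_assoc _ g, h,
          mul_inv_cancel]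
      calc g * h₁ * y = g * h₁ * g * x * g⁻¹ := by rw [mul_assoc _ g x, hg]; group
        _ = x * (g * h₁ * g) * g⁻¹ := by rw [e, coe_mul_eq]
        _ = x * (g * h₁) := by group

end RestrictFixed

theorem card_support_of_fixed_iff {n k : ℕ} (hkn : k ≤ n) {x : Equiv.Perm (Fin n)}
    (hfix : ∀ i : Fin n, x i = i ↔ k ≤ (i : ℕ)) : x.support.card = k := by
  have : x.support = Finset.univ.filter fun i : Fin n => (i : ℕ) < k := by
    ext i
    simp [Equiv.Perm.mem_support, hfix]
  rw [this, Fin.card_filter_val_lt, min_eq_right hkn]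

theorem Equiv.Perm.IsThreeCycle.exists_involution_mul {α : Type*} [Fintype α] [DecidableEq α]
    {x y g : Equiv.Perm α} (hx : x.IsThreeCycle) (hg : g * x = y * g) :
    ∃ t : Equiv.Perm α, t * t = 1 ∧ t * x = y * t := by
  have hgx : ∀ i, g (x i) = y (g i) := fun i => Equiv.congr_fun hg i
  have hcyc : ∀ i, x (x (x i)) = i := fun i => by
    have := pow_orderOf_eq_one x
    rw [hx.orderOf] at this
    exact Equiv.congr_fun this i
  obtain ⟨a, ha⟩ : x.support.Nonempty := Finset.card_pos.mp (by simp [hx.card_support])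
  have hs := hx.support_eq_iff_mem_support.mpr ha
  rw [Equiv.Perm.mem_support] at ha
  have hout : ∀ p, p ≠ a → p ≠ x a → p ≠ x (x a) → x p = p := fun p h1 h2 h3 => by
    rw [← Equiv.Perm.notMem_support, hs]
    simp [h1, h2, h3]
  have ha2 : x (x a) ≠ a := fun h => ha (by rw [← h, hcyc, h])
  refine exists_involution_mul_threeCycle (a := a) (d := g a) ha ha2 (hcyc a) hout ?_ ?_ ?_ ?_
  · rwa [← hgx, Ne, g.injective.eq_iff]
  · rwa [← hgx, ← hgx, Ne, g.injective.eq_iff]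
  · rw [← hgx, ← hgx, ← hgx, hcyc]
  · intro p
    obtain ⟨p, rfl⟩ := g.surjective p
    simp only [← hgx, Ne, g.injective.eq_iff]
    exact hout p

theorem Equiv.Perm.IsSwap.exists_involution_mul {α : Type*} [DecidableEq α]
    {x y g : Equiv.Perm α} (hx : x.IsSwap) (hg : g * x = y * g) :
    ∃ t : Equiv.Perm α, t * t = 1 ∧ t * x = y * t := by
  obtain ⟨a, b, hab, rfl⟩ := hx
  have hy : y = Equiv.swap (g a) (g b) := by
    rw [Equiv.mul_swap_eq_swap_mul] at hg
    exact (mul_right_cancel hg).symm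
  rw [hy]
  exact exists_involution_mul_swap hab (g.injective.ne hab)

theorem Equiv.Perm.mul_self_eq_one_of_cycleType_eq_replicate {α : Type*} [Fintype α]
    [DecidableEq α] {x : Equiv.Perm α} {m : ℕ} (hx : x.cycleType = Multiset.replicate m 2) :
    x * x = 1 := by
  rw [← sq, ← orderOf_dvd_iff_pow_eq_one, ← Equiv.Perm.lcm_cycleType, hx, Multiset.lcm_dvd]
  intro b hb
  rw [Multiset.eq_of_mem_replicate hb]

theorem isMultFreeRel_of_cycleType {n : ℕ} {x : Equiv.Perm (Fin n)}
    {θ : Equiv.Perm {i : Fin n // x i = i} →* ℂˣ} (hθ : θ = 1 ∨ θ = signComplex _)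
    (h : x.cycleType = {2} ∨ x.cycleType = {3} ∨
      (∃ m, x.cycleType = Multiset.replicate m 2) ∧ θ = signComplex _) :
    IsMultFreeRel (Subgroup.centralizer ({x} : Set (Equiv.Perm (Fin n))))
      (fun g => (θ (restrictFixed x g) : ℂ)) := by
  refine isMultFreeRel_restrictFixed_of_forall_exists hθ fun y g hg => ?_
  rcases h with h | h | ⟨⟨m, h⟩, h'⟩
  · exact Or.inl
      (Equiv.Perm.IsSwap.exists_involution_mul (Equiv.Perm.isSwap_iff_cycleType.mpr h) hg)
  · exact Or.inl (Equiv.Perm.IsThreeCycle.exists_involution_mul h hg)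
  · have hx := Equiv.Perm.mul_self_eq_one_of_cycleType_eq_replicate h
    have hy : y * y = 1 := by
      rw [← mul_inv_eq_iff_eq_mul.mpr hg]
      calc g * x * g⁻¹ * (g * x * g⁻¹) = g * (x * x) * g⁻¹ := by group
        _ = 1 := by rw [hx]; group
    exact (exists_involution_or_exists_commuting hx hy).imp_right fun hz => ⟨h', hz⟩

theorem cycleType_of_isMultFreeRel {n k : ℕ} (hn : 7 ≤ n) (hk : 2 ≤ k) (hkn : k ≤ n)
    {x : Equiv.Perm (Fin n)} (hfix : ∀ i : Fin n, x i = i ↔ k ≤ (i : ℕ))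
    {θ : Equiv.Perm {i : Fin n // x i = i} →* ℂˣ} (hθ : θ = 1 ∨ θ = signComplex _)
    (hMF : IsMultFreeRel (Subgroup.centralizer ({x} : Set (Equiv.Perm (Fin n))))
      (fun g => (θ (restrictFixed x g) : ℂ))) :
    x.cycleType = {2} ∨ x.cycleType = {3} ∨
      (∃ m, x.cycleType = Multiset.replicate m 2) ∧ θ = signComplex _ := by
  have hcard := card_support_of_fixed_iff hkn hfix
  by_cases hlong : ∃ a, x a ≠ a ∧ x (x a) ≠ a ∧ x (x (x a)) ≠ a
  · obtain ⟨a, h1, h2, h3⟩ := hlong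
    obtain ⟨g, y, hg, hN, hS⟩ := exists_conj_of_long_cycle (by simpa using hn) h1 h2 h3
    exact absurd hMF (not_isMultFreeRel_restrictFixed hθ hg hN (Or.inr hS))
  have hle : ∀ u, x u = u ∨ x (x u) = u ∨ x (x (x u)) = u := fun u => by
    by_contra! h
    exact hlong ⟨u, h⟩
  by_cases hthree : ∃ a, x a ≠ a ∧ x (x a) ≠ a
  · obtain ⟨a, h1, h2⟩ := hthree
    by_cases hb : ∃ b, x b ≠ b ∧ b ≠ a ∧ b ≠ x a ∧ b ≠ x (x a)
    · obtain ⟨b, hb, hba⟩ := hb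
      obtain ⟨c, hc⟩ : ∃ c, c ∉ ({a, x a, x (x a), b, x b, x (x b)} : Finset (Fin n)) := by
        by_contra! h
        have hle := Finset.card_le_six (a := a) (b := x a) (c := x (x a)) (d := b) (e := x b)
          (f := x (x b))
        rw [Finset.eq_univ_of_forall h, Finset.card_univ, Fintype.card_fin] at hle
        lia
      simp only [Finset.mem_insert, Finset.mem_singleton, not_or] at hc
      obtain ⟨g, y, hg, hN, hS⟩ := exists_conj_of_three_cycle hle h1 h2 hb hba
        ⟨hc.1, hc.2.1, hc.2.2.1⟩ hc.2.2.2
      exact absurd hMF (not_isMultFreeRel_restrictFixed hθ hg hN (Or.inr hS))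
    · refine Or.inr (Or.inl (card_support_eq_three_iff.mp ?_))
      have hs : x.support = {a, x a, x (x a)} := by
        ext b
        simp only [Equiv.Perm.mem_support, Finset.mem_insert, Finset.mem_singleton]
        refine ⟨fun h => by grind, ?_⟩
        rintro (rfl | rfl | rfl) <;> simpa using h1
      rw [hs, Finset.card_eq_three]
      exact ⟨_, _, _, h1.symm, h2.symm, by simpa using h1.symm, rfl⟩
  have hinv : ∀ u, x (x u) = u := fun u => by
    by_contra h
    exact hthree ⟨u, fun e => h (by rw [e, e]), h⟩
  have hct := Equiv.Perm.cycleType_of_pow_prime_eq_one (σ := x) (p := 2)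
    (Equiv.ext fun u => hinv u)
  rcases hθ with rfl | hθ
  · have hsum := x.sum_cycleType
    rw [hcard, hct, Multiset.sum_replicate, smul_eq_mul] at hsum
    by_cases hm : x.cycleType.card = 1
    · rw [hm] at hct
      exact Or.inl hct
    by_cases hnk : k + 2 ≤ n
    · have h0 : x ⟨0, by lia⟩ ≠ ⟨0, by lia⟩ := by
        rw [Ne, hfix]
        simp only
        lia
      set a : Fin n := ⟨0, by lia⟩
      obtain ⟨c, hc, hc'⟩ : ∃ c ∈ x.support, c ∉ ({a, x a} : Finset (Fin n)) := by
        apply Finset.exists_mem_notMem_of_card_lt_card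
        rw [hcard]
        exact Finset.card_le_two.trans_lt (by lia)
      simp only [Finset.mem_insert, Finset.mem_singleton, not_or] at hc'
      obtain ⟨g, y, hg, hN⟩ := exists_conj_of_involution hinv h0 (Equiv.Perm.mem_support.mp hc)
        hc'.1 hc'.2 ((hfix ⟨k, by lia⟩).mpr le_rfl)
        ((hfix ⟨k + 1, by lia⟩).mpr (Nat.le_succ k)) (by simp)
      exact absurd hMF (not_isMultFreeRel_restrictFixed (Or.inl rfl) hg hN (Or.inl rfl))
    · have : Subsingleton {i : Fin n // x i = i} := ⟨fun i j => by
        have hi := (hfix _).mp i.2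
        have hj := (hfix _).mp j.2
        apply Subtype.ext
        apply Fin.ext
        lia⟩
      refine Or.inr (Or.inr ⟨⟨_, hct⟩, MonoidHom.ext fun p => ?_⟩)
      rw [Subsingleton.elim p 1, map_one, map_one]
  · exact Or.inr (Or.inr ⟨⟨_, hct⟩, hθ⟩)

theorem stmt0 (n k : ℕ) (hn : 7 ≤ n) (hk : 2 ≤ k) (hkn : k ≤ n)
    (x : Equiv.Perm (Fin n))
    -- the fixed points of `x` are exactly `{k+1,…,n}`
    (hfix : ∀ i : Fin n, x i = i ↔ k ≤ (i : ℕ))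
    -- `θ` is either the trivial or the sign character of the symmetric group on the
    -- fixed-point set of `x`
    (θ : Equiv.Perm {i : Fin n // x i = i} →* ℂˣ)
    (hθ : θ = 1 ∨ θ = signComplex {i : Fin n // x i = i}) :
    IsMultFreeRel (Subgroup.centralizer ({x} : Set (Equiv.Perm (Fin n))))
        (fun g => (θ (restrictFixed x g) : ℂ)) ↔
      (x.cycleType = {2} ∧ k = 2) ∨ (x.cycleType = {3} ∧ k = 3) ∨
        ((∃ m, k = 2 * m ∧ x.cycleType = Multiset.replicate m 2) ∧
          θ = signComplex {i : Fin n // x i = i}) := by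
  have hsum := x.sum_cycleType
  rw [card_support_of_fixed_iff hkn hfix] at hsum
  constructor
  · intro hMF
    rcases cycleType_of_isMultFreeRel hn hk hkn hfix hθ hMF with h | h | ⟨⟨m, h⟩, h'⟩
    · exact Or.inl ⟨h, by simpa [h] using hsum.symm⟩
    · exact Or.inr (Or.inl ⟨h, by simpa [h] using hsum.symm⟩)
    · exact Or.inr (Or.inr ⟨⟨m, by simpa [h, mul_comm] using hsum.symm, h⟩, h'⟩)
  · intro h
    refine isMultFreeRel_of_cycleType hθ ?_
    rcases h with ⟨h, -⟩ | ⟨h, -⟩ | ⟨⟨m, -, h⟩, h'⟩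
    · exact Or.inl h
    · exact Or.inr (Or.inl h)
    · exact Or.inr (Or.inr ⟨⟨m, h⟩, h'⟩)
end

section
/- Let k ≥ 10 and n = 2k. Let S_k≀S_2 denote the subgroup of S_{2k} consisting of permutations g with g({1,…,k}) equal to {1,…,k} or to {k+1,…,2k}, and let A_k×A_k denote the subgroup of permutations mapping {1,…,k} to itself whose restrictions to {1,…,k} and to {k+1,…,2k} are both even. Then: (i) the permutation character of S_{2k} on the cosets of A_k×A_k is not multiplicity-free; (ii) for every subgroup G with A_k×A_k < G ≤ S_k≀S_2 (strict containment of A_k×A_k in G), the permutation character of S_{2k} on the cosets of G is multiplicity-free. -/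
/-- The permutation character of `G` on the cosets of `H` is multiplicity-free:
every irreducible complex representation of `G` has at most a one-dimensional
subspace of `H`-fixed vectors. -/
noncomputable def IsMultFree {G : Type} [Group G] (H : Subgroup G) : Prop :=
  ∀ V : FDRep ℂ G, CategoryTheory.Simple V →
    Module.finrank ℂ (Representation.invariants (V.ρ.comp H.subtype)) ≤ 1

/-- The subgroup of permutations of `α` mapping the set defined by `p` to itself. -/
def blockStab {α : Type*} (p : α → Prop) : Subgroup (Equiv.Perm α) where
  carrier := {g | ∀ i : α, p i ↔ p (g i)}
  one_mem' := by intro i; simp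
  mul_mem' := by
    intro a b ha hb i
    simpa [Equiv.Perm.mul_apply] using (hb i).trans (ha (b i))
  inv_mem' := by
    intro g hg i
    simpa using (hg (g⁻¹ i)).symm

/-- Restriction of a block-preserving permutation to the block `{i // p i}`. -/
def restrictBlock {α : Type*} (p : α → Prop) : blockStab p →* Equiv.Perm {i // p i} where
  toFun g := Equiv.Perm.subtypePerm g.1 (fun i => (g.2 i).symm)
  map_one' := by
    ext i
    simp [Equiv.Perm.subtypePerm]
  map_mul' a b := by
    ext i
    simp [Equiv.Perm.subtypePerm, Equiv.Perm.mul_apply]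

/-- Restriction of a block-preserving permutation to the complementary block `{i // ¬ p i}`. -/
def restrictCoblock {α : Type*} (p : α → Prop) : blockStab p →* Equiv.Perm {i // ¬ p i} where
  toFun g := Equiv.Perm.subtypePerm g.1 (fun i => not_congr (g.2 i).symm)
  map_one' := by
    ext i
    simp [Equiv.Perm.subtypePerm]
  map_mul' a b := by
    ext i
    simp [Equiv.Perm.subtypePerm, Equiv.Perm.mul_apply]

/-- The subgroup of permutations of `α` mapping the set defined by `p` to itself and
restricting to even permutations of both `{i // p i}` and its complement. -/
def evenEven {α : Type*} [Fintype α] [DecidableEq α] (p : α → Prop) [DecidablePred p] :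
    Subgroup (Equiv.Perm α) :=
  ((Equiv.Perm.sign.comp (restrictBlock p)).ker ⊓
      (Equiv.Perm.sign.comp (restrictCoblock p)).ker).map (blockStab p).subtype

/-- The subgroup of permutations preserving the partition of `α` into the fibres of a
colouring `c` (two points get mapped to the same fibre iff they lie in the same fibre). -/
def colorStab {α : Type*} {β : Sort*} (c : α → β) : Subgroup (Equiv.Perm α) where
  carrier := {g | ∀ i j : α, c i = c j ↔ c (g i) = c (g j)}
  one_mem' := by intro i j; simp
  mul_mem' := by
    intro a b ha hb i j
    simpa [Equiv.Perm.mul_apply] using (hb i j).trans (ha (b i) (b j))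
  inv_mem' := by
    intro g hg i j
    simpa using (hg (g⁻¹ i) (g⁻¹ j)).symm

open Representation MonoidAlgebra in
/-- A nonzero element of the group algebra of a finite group acts nontrivially on some irreducible
representation. -/
theorem exists_irreducible_smul_ne_zero {G : Type} [Group G] [Finite G] (e : MonoidAlgebra ℂ G)
    (he : e ≠ 0) :
    ∃ S : Submodule (MonoidAlgebra ℂ G) (MonoidAlgebra ℂ G),
      IsSimpleModule (MonoidAlgebra ℂ G) S ∧ ∃ v : S, e • v ≠ 0 := by
  by_contra! h
  refine he ?_
  have key : ∀ x ∈ sSup {S : Submodule (MonoidAlgebra ℂ G) (MonoidAlgebra ℂ G) |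
      IsSimpleModule (MonoidAlgebra ℂ G) S}, e • x = 0 := by
    intro x hx
    rw [sSup_eq_iSup'] at hx
    induction hx using Submodule.iSup_induction' with
    | mem S x hx => simpa using congrArg Subtype.val (h S.1 S.2 ⟨x, hx⟩)
    | zero => simp
    | add x y _ _ hx hy => rw [smul_add, hx, hy, add_zero]
  rw [IsSemisimpleModule.sSup_simples_eq_top] at key
  simpa using key 1 trivial

theorem FDRep.simple_of_isIrreducible {G : Type} [Group G] [Finite G] {V : Type} [AddCommGroup V]
    [Module ℂ V] [FiniteDimensional ℂ V] (ρ : Representation ℂ G V) [ρ.IsIrreducible] :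
    CategoryTheory.Simple (FDRep.of ρ) := by
  rw [FDRep.simple_iff_end_is_rank_one,
    ← (FDRep.forget₂HomLinearEquiv (FDRep.of ρ) (FDRep.of ρ)).finrank_eq,
    (Rep.homLinearEquiv _ _).finrank_eq]
  exact Representation.IsIrreducible.finrank_intertwiningMap_self ρ

/-- An invariant subspace of a simple representation is trivial. -/
theorem FDRep.eq_bot_or_eq_top_of_simple {G : Type} [Group G] (V : FDRep ℂ G)
    [CategoryTheory.Simple V] (W : Submodule ℂ V) (hW : ∀ g, ∀ w ∈ W, V.ρ g w ∈ W) :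
    W = ⊥ ∨ W = ⊤ := by
  let ρ' : Subrepresentation V.ρ := ⟨W, fun g w hw => hW g w hw⟩
  let ι : FDRep.of ρ'.toRepresentation ⟶ V :=
    ⟨CategoryTheory.InducedCategory.homMk (ModuleCat.ofHom W.subtype), fun g => by ext; rfl⟩
  have hinj : Function.Injective ι := W.injective_subtype
  have : CategoryTheory.Mono ι := CategoryTheory.ConcreteCategory.mono_of_injective _ hinj
  by_cases h0 : ι = 0
  · left
    rw [Submodule.eq_bot_iff]
    intro w hw
    exact congrArg (fun f : FDRep.of ρ'.toRepresentation ⟶ V => f.hom.hom.hom ⟨w, hw⟩) h0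
  · right
    have : CategoryTheory.IsIso ι := CategoryTheory.isIso_of_mono_of_nonzero h0
    rw [Submodule.eq_top_iff']
    intro v
    have hv : ι ((CategoryTheory.inv ι) v) = v := by
      rw [← CategoryTheory.ConcreteCategory.comp_apply]; simp
    rw [← hv]
    exact Subtype.property (p := (· ∈ W)) _

open Classical in
/-- Gelfand criterion: if every double coset of `H` is closed under inversion, then the permutation
character on the cosets of `H` is multiplicity-free. -/
theorem isMultFree_of_inv_mem {G : Type} [Group G] [Finite G] (H : Subgroup G)
    (hH : ∀ g : G, ∃ a ∈ H, ∃ b ∈ H, a * g * b = g⁻¹) : IsMultFree H := by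
  intro V hV
  set F : Submodule ℂ V := Representation.invariants (V.ρ.comp H.subtype) with hF
  have memF : ∀ v, v ∈ F ↔ ∀ h ∈ H, V.ρ h v = v := by
    intro v
    simp [hF, Representation.mem_invariants]
  have := Fintype.ofFinite G
  let N : Module.End ℂ V := ∑ h : H, V.ρ h
  have hNapp : ∀ v, N v = ∑ h : H, V.ρ h v := fun v => by simp [N]
  have mulN : ∀ h ∈ H, V.ρ h * N = N := by
    intro h hh
    simp only [N, Finset.mul_sum, ← map_mul]
    exact Fintype.sum_equiv (Equiv.mulLeft (⟨h, hh⟩ : H)) _ _ fun x => rfl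
  have Nmul : ∀ h ∈ H, N * V.ρ h = N := by
    intro h hh
    simp only [N, Finset.sum_mul, ← map_mul]
    exact Fintype.sum_equiv (Equiv.mulRight (⟨h, hh⟩ : H)) _ _ fun x => rfl
  have NmemF : ∀ v, N v ∈ F := fun v => (memF _).2 fun h hh => by
    conv_rhs => rw [← mulN h hh]
    rfl
  have Ninv : ∀ v ∈ F, N v = (Fintype.card H : ℂ) • v := by
    intro v hv
    rw [hNapp, Finset.sum_congr rfl fun h _ => (memF v).1 hv _ (Subtype.prop h)]
    simp [Nat.cast_smul_eq_nsmul]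
  have cardne : (Fintype.card H : ℂ) ≠ 0 := by exact_mod_cast Fintype.card_ne_zero
  let T : G → Module.End ℂ V := fun g => N * V.ρ g * N
  have Tdc : ∀ g, T g⁻¹ = T g := by
    intro g
    obtain ⟨a, ha, b, hb, hg⟩ := hH g
    simp only [T, ← hg, map_mul]
    rw [← mul_assoc, ← mul_assoc, Nmul a ha, mul_assoc, mul_assoc, mulN b hb, ← mul_assoc]
  have TT : ∀ g g', T g * T g' = (Fintype.card H : ℂ) • ∑ x : H, T (g * x * g') := by
    intro g g'
    have NN : N * N = (Fintype.card H : ℂ) • N := by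
      ext v; exact Ninv _ (NmemF v)
    calc T g * T g' = N * V.ρ g * (N * N) * V.ρ g' * N := by simp only [T, mul_assoc]
      _ = (Fintype.card H : ℂ) • (N * V.ρ g * N * V.ρ g' * N) := by
        rw [NN]; simp only [mul_smul_comm, smul_mul_assoc]
      _ = _ := by
        congr 1
        conv_lhs => enter [1, 1, 2]; simp only [N]
        simp only [T, Finset.mul_sum, Finset.sum_mul, map_mul, mul_assoc]
  have Tcomm : ∀ g g', T g * T g' = T g' * T g := by
    intro g g'
    calc T g * T g' = T g'⁻¹ * T g⁻¹ := by
          rw [TT, TT, ← Equiv.sum_comp (Equiv.inv H)]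
          congr 1
          refine Finset.sum_congr rfl fun x _ => ?_
          rw [← Tdc]
          simp [mul_assoc]
      _ = T g' * T g := by rw [Tdc, Tdc]
  have span_orbit : ∀ v : V, v ≠ 0 → Submodule.span ℂ (Set.range fun g => V.ρ g v) = ⊤ := by
    intro v hv
    refine (FDRep.eq_bot_or_eq_top_of_simple V _ fun g w hw => ?_).resolve_left fun h => ?_
    · induction hw using Submodule.span_induction with
      | mem x hx =>
        obtain ⟨g', rfl⟩ := hx
        exact Submodule.subset_span ⟨g * g', by simp⟩
      | zero => simp
      | add x y _ _ hx hy => rw [map_add]; exact add_mem hx hy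
      | smul a x _ hx => rw [map_smul]; exact Submodule.smul_mem _ _ hx
    · rw [Submodule.span_eq_bot] at h
      exact hv (by simpa using h _ ⟨1, rfl⟩)
  have key : ∀ (E : Submodule ℂ V) (v : V), v ∈ F → v ≠ 0 → (∀ g, T g v ∈ E) → F ≤ E := by
    intro E v hvF hv hE u hu
    have hD : (⊤ : Submodule ℂ V) ≤ E.comap N := by
      rw [← span_orbit v hv, Submodule.span_le]
      rintro _ ⟨g, rfl⟩
      have h1 := hE g
      have h2 : T g v = (Fintype.card H : ℂ) • N (V.ρ g v) := by
        change N (V.ρ g (N v)) = _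
        rw [Ninv v hvF, map_smul, map_smul]
      rw [h2] at h1
      exact (E.smul_mem_iff cardne).1 h1
    have h3 : N u ∈ E := hD (Submodule.mem_top (x := u))
    rw [Ninv u hu] at h3
    exact (E.smul_mem_iff cardne).1 h3
  by_cases hbot : F = ⊥
  · rw [hbot]; simp
  obtain ⟨v, hvF, hv⟩ := F.ne_bot_iff.1 hbot
  have scalar : ∀ g, ∃ μ : ℂ, ∀ u ∈ F, T g u = μ • u := by
    intro g
    have hT : ∀ u ∈ F, T g u ∈ F := fun u _ => NmemF _
    have : Nontrivial F := Submodule.nontrivial_iff_ne_bot.2 hbot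
    obtain ⟨μ, hμ⟩ := Module.End.exists_eigenvalue ((T g).restrict hT)
    obtain ⟨u, hu⟩ := hμ.exists_hasEigenvector
    have hu1 : T g u = μ • (u : V) := congrArg Subtype.val hu.apply_eq_smul
    have hu0 : (u : V) ≠ 0 := fun h => hu.2 (Subtype.ext h)
    refine ⟨μ, fun w hw => Module.End.mem_eigenspace_iff.1
      (key (Module.End.eigenspace (T g) μ) u u.2 hu0 (fun g' => ?_) hw)⟩
    rw [Module.End.mem_eigenspace_iff, ← Module.End.mul_apply, Tcomm, Module.End.mul_apply, hu1,
      map_smul]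
  have hle : F ≤ Submodule.span ℂ {v} := by
    refine key _ v hvF hv fun g => ?_
    obtain ⟨μ, hμ⟩ := scalar g
    rw [hμ v hvF]
    exact Submodule.smul_mem _ _ (Submodule.mem_span_singleton_self v)
  exact (Submodule.finrank_mono hle).trans (finrank_span_singleton hv).le

open Classical in
/-- A character `χ` of a subgroup `K` of a finite group occurs in some simple representation. -/
theorem exists_simple_eigenvector {G : Type} [Group G] [Finite G] (K : Subgroup G) (χ : K →* ℂ) :
    ∃ V : FDRep ℂ G, CategoryTheory.Simple V ∧ ∃ v : V, v ≠ 0 ∧ ∀ h : K, V.ρ h v = χ h • v := by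
  have := Fintype.ofFinite K
  let e : MonoidAlgebra ℂ G := ∑ h : K, MonoidAlgebra.single (h : G) (χ h⁻¹)
  have hmul : ∀ h : K, MonoidAlgebra.single (h : G) (1 : ℂ) * e = χ h • e := by
    intro h
    simp only [e, Finset.mul_sum, Finset.smul_sum, MonoidAlgebra.single_mul_single, one_mul]
    refine Fintype.sum_equiv (Equiv.mulLeft h) _ _ fun x => ?_
    simp only [Equiv.coe_mulLeft, Subgroup.coe_mul, mul_inv_rev, map_mul, MonoidAlgebra.smul_single,
      smul_eq_mul]
    rw [mul_left_comm, ← map_mul, mul_inv_cancel, map_one, mul_one]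
  have he : e ≠ 0 := by
    intro h0
    have h1 := congrArg (fun f : MonoidAlgebra ℂ G => f.coeff 1) h0
    have hone : ∀ c : K, (Finsupp.single (c : G) (χ c)⁻¹) 1 = if c = 1 then 1 else 0 := by
      intro c
      by_cases hc : c = 1 <;> simp [hc]
    simp [e, MonoidAlgebra.coeff_single, hone] at h1
  obtain ⟨S, hS, v, hv⟩ := exists_irreducible_smul_ne_zero e he
  let ρ := Representation.ofModule' (k := ℂ) (G := G) S
  have hρ : ∀ g (u : S), ρ g u = MonoidAlgebra.single g (1 : ℂ) • u := fun g u => rfl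
  have hirr : ρ.IsIrreducible := by
    have : Nontrivial S := IsSimpleModule.nontrivial (MonoidAlgebra ℂ G) S
    refine { exists_pair_ne := ⟨⊥, ⊤, fun h => ?_⟩, eq_bot_or_eq_top := fun W => ?_ }
    · obtain ⟨u, hu⟩ := exists_ne (0 : S)
      have : u ∈ (⊤ : Subrepresentation ρ) := trivial
      rw [← h] at this
      exact hu this
    · let N : Submodule (MonoidAlgebra ℂ G) S :=
        { W.toSubmodule with
          smul_mem' := fun a u hu => by
            induction a using MonoidAlgebra.induction_on with
            | of g => exact W.apply_mem_toSubmodule g hu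
            | add x y hx hy => rw [add_smul]; exact W.toSubmodule.add_mem hx hy
            | smul r x hx => rw [smul_assoc]; exact W.toSubmodule.smul_mem r hx }
      have hN : ∀ u, u ∈ N ↔ u ∈ W := fun u => Iff.rfl
      refine (eq_bot_or_eq_top N).imp (fun h => ?_) fun h => ?_
      · exact SetLike.ext fun u => by rw [← hN, h]; rfl
      · exact SetLike.ext fun u => by rw [← hN, h]; rfl
  have : FiniteDimensional ℂ S := by
    have : FiniteDimensional ℂ (MonoidAlgebra ℂ G) :=
      .of_injective (MonoidAlgebra.coeffLinearEquiv ℂ).toLinearMap (LinearEquiv.injective _)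
    exact inferInstanceAs (FiniteDimensional ℂ (S.restrictScalars ℂ))
  refine ⟨FDRep.of ρ, FDRep.simple_of_isIrreducible ρ, e • v, hv, fun h => ?_⟩
  change MonoidAlgebra.single (h : G) (1 : ℂ) • e • v = _
  rw [← mul_smul, hmul, smul_assoc]
section Blocks

open Equiv Equiv.Perm

variable {α : Type*} {p : α → Prop}

theorem swap_mem_blockStab [DecidableEq α] {a b : α} (h : p a ↔ p b) : swap a b ∈ blockStab p := by
  intro i
  rcases eq_or_ne i a with rfl | ha
  · simpa using h
  rcases eq_or_ne i b with rfl | hb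
  · simpa using h.symm
  rw [swap_apply_of_ne_of_ne ha hb]

theorem card_filter_and_not_eq [Fintype α] [DecidablePred p] (g : Perm α) :
    (Finset.univ.filter fun i => p i ∧ ¬ p (g i)).card =
      (Finset.univ.filter fun i => ¬ p i ∧ p (g i)).card := by
  have h1 := Finset.card_filter_add_card_filter_not (s := Finset.univ.filter p) (fun i => p (g i))
  have h2 := Finset.card_filter_add_card_filter_not (s := Finset.univ.filter fun i => p (g i)) p
  have h3 : (Finset.univ.filter fun i => p (g i)).card = (Finset.univ.filter p).card :=
    Finset.card_equiv g (by simp)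
  simp only [Finset.filter_filter] at h1 h2
  simp only [and_comm (a := p (g _))] at h2
  omega

theorem exists_two_of_card [Fintype α] {q : α → Prop} [DecidablePred q]
    (h : 1 < (Finset.univ.filter q).card) : ∃ a b, a ≠ b ∧ q a ∧ q b := by
  obtain ⟨a, ha, b, hb, hab⟩ := Finset.one_lt_card.1 h
  exact ⟨a, b, hab, by simpa using ha, by simpa using hb⟩

theorem not_iff_of_mem_colorStab {x : Perm α} (hx : x ∈ colorStab (fun i => (p i : Prop)))
    (hxK : x ∉ blockStab p) (i : α) : p (x i) ↔ ¬ p i := by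
  obtain ⟨j, hj⟩ : ∃ j, ¬ (p j ↔ p (x j)) := by
    by_contra! h
    exact hxK h
  have := hx i j
  simp only [eq_iff_iff] at this
  tauto

open Classical in
theorem exists_involution [Finite α] (g : Perm α) : ∃ w : Perm α, w * w = 1 ∧ ∀ i, p (w i) ↔ p (g i) := by
  have := Fintype.ofFinite α
  have hcard := card_filter_and_not_eq (p := p) g
  rw [← Fintype.card_subtype, ← Fintype.card_subtype] at hcard
  obtain ⟨e⟩ := Fintype.card_eq.1 hcard
  let f : α → α := fun i => if hP : p i ∧ ¬ p (g i) then e ⟨i, hP⟩ else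
    if hQ : ¬ p i ∧ p (g i) then e.symm ⟨i, hQ⟩ else i
  have fP : ∀ x : {i // p i ∧ ¬ p (g i)}, f x = e x := fun x => dif_pos x.2
  have fQ : ∀ x : {i // ¬ p i ∧ p (g i)}, f x = e.symm x := fun x =>
    (dif_neg fun h => x.2.1 h.1).trans (dif_pos x.2)
  have fR : ∀ i, (p i ↔ p (g i)) → f i = i := fun i hi =>
    (dif_neg fun h => h.2 (hi.1 h.1)).trans (dif_neg fun h => h.1 (hi.2 h.2))
  have hcases : ∀ i : α, (∃ x : {j // p j ∧ ¬ p (g j)}, ↑x = i) ∨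
      (∃ x : {j // ¬ p j ∧ p (g j)}, ↑x = i) ∨ (p i ↔ p (g i)) := by
    intro i
    by_cases h1 : p i <;> by_cases h2 : p (g i) <;> simp [h1, h2]
  have hf : Function.Involutive f := by
    intro i
    rcases hcases i with ⟨x, rfl⟩ | ⟨x, rfl⟩ | hi
    · simp [fP, fQ]
    · simp [fP, fQ]
    · rw [fR i hi, fR i hi]
  refine ⟨hf.toPerm, Equiv.ext hf, fun i => ?_⟩
  rw [Function.Involutive.coe_toPerm]
  rcases hcases i with ⟨x, rfl⟩ | ⟨x, rfl⟩ | hi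
  · rw [fP]; exact iff_of_false (e x).2.1 x.2.2
  · rw [fQ]; exact iff_of_true (e.symm x).2.1 x.2.2
  · rw [fR i hi]; exact hi

theorem exists_blockStab_mul_mul_eq_inv [Finite α] (g : Perm α) : ∃ h : blockStab p, h * g * h = g⁻¹ := by
  obtain ⟨w, hw, hp⟩ := exists_involution (p := p) g⁻¹
  have hw' : ∀ i, w (w i) = i := fun i => congrArg (fun f : Perm α => f i) hw
  refine ⟨⟨g⁻¹ * w, fun i => ?_⟩, ?_⟩
  · rw [Perm.mul_apply, ← hp, hw']
  · change g⁻¹ * w * g * (g⁻¹ * w) = g⁻¹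
    simp [mul_assoc, hw]

variable [Fintype α] [DecidableEq α] [DecidablePred p]

variable (p) in
/-- The signs of the two restrictions of a block-preserving permutation. -/
def blockSigns : blockStab p →* ℤˣ × ℤˣ :=
  (Equiv.Perm.sign.comp (restrictBlock p)).prod (Equiv.Perm.sign.comp (restrictCoblock p))

theorem mem_evenEven_iff {g : Perm α} :
    g ∈ evenEven p ↔ ∃ h : g ∈ blockStab p, blockSigns p ⟨g, h⟩ = 1 := by
  simp [evenEven, blockSigns, Prod.ext_iff]

theorem coe_mem_evenEven {g : blockStab p} (h : blockSigns p g = 1) :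
    (g : Perm α) ∈ evenEven p :=
  mem_evenEven_iff.2 ⟨g.2, h⟩

theorem blockSigns_swap {a b : α} (hab : a ≠ b) (h : p a ↔ p b) :
    blockSigns p ⟨swap a b, swap_mem_blockStab h⟩ = if p a then (-1, 1) else (1, -1) := by
  by_cases ha : p a
  · have hb := h.1 ha
    have h1 : restrictBlock p ⟨swap a b, swap_mem_blockStab h⟩ = swap ⟨a, ha⟩ ⟨b, hb⟩ := by
      ext i
      simp only [restrictBlock, MonoidHom.coe_mk, OneHom.coe_mk, subtypePerm_apply, swap_apply_def,
        Subtype.ext_iff]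
      split_ifs <;> rfl
    have h2 : restrictCoblock p ⟨swap a b, swap_mem_blockStab h⟩ = 1 := by
      ext i
      exact swap_apply_of_ne_of_ne (fun hi => i.2 (hi ▸ ha)) (fun hi => i.2 (hi ▸ hb))
    simp [blockSigns, h1, h2, ha, hab]
  · have hb : ¬ p b := fun hb => ha (h.2 hb)
    have h1 : restrictCoblock p ⟨swap a b, swap_mem_blockStab h⟩ = swap ⟨a, ha⟩ ⟨b, hb⟩ := by
      ext i
      simp only [restrictCoblock, MonoidHom.coe_mk, OneHom.coe_mk, subtypePerm_apply,
        swap_apply_def, Subtype.ext_iff]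
      split_ifs <;> rfl
    have h2 : restrictBlock p ⟨swap a b, swap_mem_blockStab h⟩ = 1 := by
      ext i
      exact swap_apply_of_ne_of_ne (fun hi => ha (hi ▸ i.2)) (fun hi => hb (hi ▸ i.2))
    simp [blockSigns, h1, h2, ha, hab]

/-- If two points lie in the same block, as well as their preimages under `g`, then there is a
block-preserving permutation whose conjugate by `g` is also block-preserving, with an arbitrary
sign on the respective blocks of these points. -/
theorem exists_blockSigns_conj (g : Perm α) {a b : α} (hab : a ≠ b) (h : p a ↔ p b)
    (hg : p (g⁻¹ a) ↔ p (g⁻¹ b)) (s : ℤˣ) :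
    ∃ r r' : blockStab p, (r' : Perm α) = g⁻¹ * r * g ∧
      blockSigns p r = (if p a then (s, 1) else (1, s)) ∧
      blockSigns p r' = (if p (g⁻¹ a) then (s, 1) else (1, s)) := by
  rcases Int.units_eq_one_or s with rfl | rfl
  · exact ⟨1, 1, by simp, by simp [Prod.ext_iff], by simp [Prod.ext_iff]⟩
  · refine ⟨_, _, ?_, blockSigns_swap hab h, blockSigns_swap (g⁻¹.injective.ne hab) hg⟩
    simpa using Equiv.swap_apply_apply g⁻¹ a b

theorem exists_evenEven_mul_mul_eq_inv (g : Perm α)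
    (hA : ∃ a b, a ≠ b ∧ (p a ∧ p (g⁻¹ a)) ∧ (p b ∧ p (g⁻¹ b)))
    (hB : ∃ a b, a ≠ b ∧ (¬ p a ∧ ¬ p (g⁻¹ a)) ∧ (¬ p b ∧ ¬ p (g⁻¹ b))) :
    ∃ x ∈ evenEven p, ∃ y ∈ evenEven p, x * g * y = g⁻¹ := by
  obtain ⟨h, hh⟩ := exists_blockStab_mul_mul_eq_inv (p := p) g
  obtain ⟨a, b, hab, ha, hb⟩ := hA
  obtain ⟨c, d, hcd, hc, hd⟩ := hB
  obtain ⟨r, r', hr, hs, hs'⟩ := exists_blockSigns_conj g hab (iff_of_true ha.1 hb.1)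
    (iff_of_true ha.2 hb.2) (blockSigns p h).1
  obtain ⟨q, q', hq, ht, ht'⟩ := exists_blockSigns_conj g hcd (iff_of_false hc.1 hd.1)
    (iff_of_false hc.2 hd.2) (blockSigns p h).2
  simp only [ha, hc, if_true, if_false] at hs hs' ht ht'
  refine ⟨(h * (r * q) : blockStab p), coe_mem_evenEven ?_,
    ((r' * q')⁻¹ * h : blockStab p), coe_mem_evenEven ?_, ?_⟩
  · simp [hs, ht, Prod.ext_iff]
  · simp [hs', ht', Prod.ext_iff]
  · simp only [Subgroup.coe_mul, Subgroup.coe_inv, hr, hq]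
    refine Eq.trans ?_ hh
    group

theorem units_int_prod_adjust : ∀ u z : ℤˣ × ℤˣ, z = 1 ∨ ∃ s : ℤˣ × ℤˣ,
    (u * s = 1 ∨ u * s = z) ∧ (u * s.swap = 1 ∨ u * s.swap = z) := by
  decide

theorem exists_mem_mul_mul_eq_inv {G : Subgroup (Perm α)} (hG : evenEven p < G)
    (hGK : G ≤ blockStab p) (g : Perm α)
    (hA : ∃ a b, a ≠ b ∧ (p a ∧ ¬ p (g⁻¹ a)) ∧ (p b ∧ ¬ p (g⁻¹ b)))
    (hB : ∃ a b, a ≠ b ∧ (¬ p a ∧ p (g⁻¹ a)) ∧ (¬ p b ∧ p (g⁻¹ b))) :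
    ∃ x ∈ G, ∃ y ∈ G, x * g * y = g⁻¹ := by
  obtain ⟨z, hzG, hz⟩ := SetLike.exists_of_lt hG
  have hzσ : blockSigns p ⟨z, hGK hzG⟩ ≠ 1 := fun h => hz (coe_mem_evenEven h)
  have mem : ∀ x : blockStab p, blockSigns p x = 1 ∨ blockSigns p x = blockSigns p ⟨z, hGK hzG⟩ →
      (x : Perm α) ∈ G := by
    rintro x (hx | hx)
    · exact hG.le (coe_mem_evenEven hx)
    · have h1 : (⟨z, hGK hzG⟩⁻¹ * x : blockStab p).1 ∈ evenEven p :=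
        coe_mem_evenEven (by rw [map_mul, map_inv, hx, inv_mul_cancel])
      simpa using G.mul_mem hzG (hG.le h1)
  obtain ⟨h, hh⟩ := exists_blockStab_mul_mul_eq_inv (p := p) g
  obtain ⟨⟨s, t⟩, hst, hts⟩ :=
    (units_int_prod_adjust (blockSigns p h) _).resolve_left hzσ
  obtain ⟨a, b, hab, ha, hb⟩ := hA
  obtain ⟨c, d, hcd, hc, hd⟩ := hB
  obtain ⟨r, r', hr, hs, hs'⟩ := exists_blockSigns_conj g hab (iff_of_true ha.1 hb.1)
    (iff_of_false ha.2 hb.2) s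
  obtain ⟨q, q', hq, ht, ht'⟩ := exists_blockSigns_conj g hcd (iff_of_false hc.1 hd.1)
    (iff_of_true hc.2 hd.2) t
  simp only [ha, hc, if_true, if_false] at hs hs' ht ht'
  refine ⟨(h * (r * q) : blockStab p), mem _ ?_, ((r' * q')⁻¹ * h : blockStab p), mem _ ?_, ?_⟩
  · simpa [hs, ht] using hst
  · simpa [hs', ht', mul_comm] using hts
  · simp only [Subgroup.coe_mul, Subgroup.coe_inv, hr, hq]
    refine Eq.trans ?_ hh
    group

/-- Overgroups of `evenEven p` preserving the partition into two blocks of equal size at least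
three are multiplicity-free. -/
theorem isMultFree_of_evenEven_lt {α : Type} [Fintype α] [DecidableEq α] {p : α → Prop}
    [DecidablePred p] {k : ℕ} (hk : 3 ≤ k) (hp : (Finset.univ.filter p).card = k)
    (hn : (Finset.univ.filter fun i => ¬ p i).card = k) {G : Subgroup (Perm α)}
    (hG : evenEven p < G) (hGc : G ≤ colorStab (fun i => (p i : Prop))) : IsMultFree G := by
  refine isMultFree_of_inv_mem G fun g => ?_
  have h1 := Finset.card_filter_add_card_filter_not (s := Finset.univ.filter p) (fun i => p (g⁻¹ i))
  have h2 := Finset.card_filter_add_card_filter_not (s := Finset.univ.filter fun i => ¬ p i)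
    (fun i => p (g⁻¹ i))
  have h3 := card_filter_and_not_eq (p := p) g⁻¹
  simp only [Finset.filter_filter] at h1 h2
  by_cases hc : 1 < (Finset.univ.filter fun i => p i ∧ p (g⁻¹ i)).card
  · obtain ⟨x, hx, y, hy, h⟩ := exists_evenEven_mul_mul_eq_inv g (exists_two_of_card hc)
      (exists_two_of_card (by omega))
    exact ⟨x, hG.le hx, y, hG.le hy, h⟩
  obtain ⟨a, b, hab, ha, hb⟩ := exists_two_of_card (q := fun i => p i ∧ ¬ p (g⁻¹ i)) (by omega)
  obtain ⟨c, d, hcd, hc, hd⟩ := exists_two_of_card (q := fun i => ¬ p i ∧ p (g⁻¹ i)) (by omega)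
  by_cases hGK : G ≤ blockStab p
  · exact exists_mem_mul_mul_eq_inv hG hGK g ⟨a, b, hab, ha, hb⟩ ⟨c, d, hcd, hc, hd⟩
  obtain ⟨x, hxG, hxK⟩ := SetLike.not_le_iff_exists.1 hGK
  have hx := not_iff_of_mem_colorStab (hGc hxG) hxK
  obtain ⟨y, hy, z, hz, h⟩ := exists_evenEven_mul_mul_eq_inv (p := p) (x * g)
    ⟨x c, x d, x.injective.ne hcd, ⟨by simp [hx, hc.1], by simpa [mul_assoc] using hc.2⟩, ⟨by simp [hx, hd.1], by simpa [mul_assoc] using hd.2⟩⟩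
    ⟨x a, x b, x.injective.ne hab, ⟨by simp [hx, ha.1], by simpa [mul_assoc] using ha.2⟩, ⟨by simp [hx, hb.1], by simpa [mul_assoc] using hb.2⟩⟩
  refine ⟨y * x, G.mul_mem (hG.le hy) hxG, z * x, G.mul_mem (hG.le hz) hxG, ?_⟩
  have : y * x * g * (z * x) = y * (x * g) * z * x := by group
  rw [this, h]
  group

theorem not_isMultFree_evenEven {α : Type} [Fintype α] [DecidableEq α] {p : α → Prop}
    [DecidablePred p] (hp : 1 < (Finset.univ.filter p).card) (t : Perm α)
    (ht : ∀ i, p (t i) ↔ ¬ p i) : ¬ IsMultFree (evenEven p) := by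
  intro hmf
  let χ : blockStab p →* ℂ :=
    ((Int.castRingHom ℂ : ℤ →* ℂ).comp (Units.coeHom ℤ)).comp
      ((MonoidHom.fst ℤˣ ℤˣ).comp (blockSigns p))
  have hχ : ∀ h, χ h = ((blockSigns p h).1 : ℤ) := fun h => rfl
  obtain ⟨V, hV, v, hv0, hv⟩ := exists_simple_eigenvector (blockStab p) χ
  have ht' : ∀ i, p (t⁻¹ i) ↔ ¬ p i := fun i => by
    have := ht (t⁻¹ i)
    rw [← Perm.mul_apply, mul_inv_cancel, Perm.one_apply] at this
    tauto
  have conj_mem : ∀ h ∈ blockStab p, t⁻¹ * h * t ∈ blockStab p := fun h hh i => by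
    simp only [Perm.mul_apply, ht', ← hh (t i), ht, not_not]
  have conj_sign : ∀ h : blockStab p,
      (blockSigns p ⟨t⁻¹ * h * t, conj_mem h h.2⟩).1 = (blockSigns p h).2 := by
    intro h
    let e : {i // p i} ≃ {i // ¬ p i} := t.subtypeEquiv fun i => by rw [ht, not_not]
    change sign (restrictBlock p _) = sign (restrictCoblock p h)
    rw [← sign_permCongr e.symm]
    congr 1
  have tfix : ∀ h ∈ evenEven p, V.ρ h (V.ρ t v) = V.ρ t v := by
    intro h hh
    obtain ⟨hK, hs⟩ := mem_evenEven_iff.1 hh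
    have h1 : h * t = t * (t⁻¹ * h * t) := by group
    rw [← Module.End.mul_apply, ← map_mul, h1, map_mul, Module.End.mul_apply,
      hv ⟨_, conj_mem h hK⟩, hχ, conj_sign ⟨h, hK⟩, hs]
    simp
  have vfix : ∀ h ∈ evenEven p, V.ρ h v = v := by
    intro h hh
    obtain ⟨hK, hs⟩ := mem_evenEven_iff.1 hh
    rw [hv ⟨h, hK⟩, hχ, hs]
    simp
  obtain ⟨u, hu⟩ := finrank_le_one_iff.1 (hmf V hV)
  obtain ⟨c, hc⟩ := hu ⟨v, fun h => vfix h h.2⟩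
  obtain ⟨d, hd⟩ := hu ⟨V.ρ t v, fun h => tfix h h.2⟩
  replace hc : c • (u : V) = v := congrArg Subtype.val hc
  replace hd : d • (u : V) = V.ρ t v := congrArg Subtype.val hd
  obtain ⟨a, b, hab, ha, hb⟩ := exists_two_of_card hp
  have hpab := iff_of_true ha hb
  have hσ := blockSigns_swap hab hpab
  rw [if_pos ha] at hσ
  have sv : V.ρ (swap a b) v = -v := by
    rw [hv ⟨_, swap_mem_blockStab hpab⟩, hχ, hσ]
    simp
  have stv : V.ρ (swap a b) (V.ρ t v) = V.ρ t v := by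
    have h1 : swap a b * t = t * (t⁻¹ * swap a b * t) := by group
    rw [← Module.End.mul_apply, ← map_mul, h1, map_mul, Module.End.mul_apply,
      hv ⟨_, conj_mem _ (swap_mem_blockStab hpab)⟩, hχ,
      conj_sign ⟨_, swap_mem_blockStab hpab⟩, hσ]
    simp
  have hc0 : c ≠ 0 := by
    rintro rfl
    exact hv0 (by rw [← hc, zero_smul])
  have htv : V.ρ t v = (d * c⁻¹) • v := by
    rw [← hd, ← hc, smul_smul, mul_assoc, inv_mul_cancel₀ hc0, mul_one]
  have h2 : V.ρ t v = 0 := by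
    have h3 := stv
    rw [htv, map_smul, sv, smul_neg] at h3
    have h4 : (2 : ℂ) • V.ρ t v = 0 := by
      rw [two_smul, htv]
      nth_rewrite 1 [← h3]
      exact neg_add_cancel _
    exact (smul_eq_zero.1 h4).resolve_left two_ne_zero
  exact hv0 (by simpa using congrArg (V.ρ t⁻¹) h2)

end Blocks

theorem stmt5 (k : ℕ) (hk : 10 ≤ k) :
    ¬ IsMultFree (evenEven (fun i : Fin (2 * k) => (i : ℕ) < k)) ∧
      ∀ G : Subgroup (Equiv.Perm (Fin (2 * k))),
        evenEven (fun i : Fin (2 * k) => (i : ℕ) < k) < G →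
        G ≤ colorStab (fun i : Fin (2 * k) => ((i : ℕ) < k : Prop)) →
        IsMultFree G := by
  have hp : (Finset.univ.filter fun i : Fin (2 * k) => (i : ℕ) < k).card = k := by
    rw [Fin.card_filter_val_lt]
    omega
  have hn : (Finset.univ.filter fun i : Fin (2 * k) => ¬ (i : ℕ) < k).card = k := by
    have := Finset.card_filter_add_card_filter_not (s := Finset.univ)
      (fun i : Fin (2 * k) => (i : ℕ) < k)
    rw [hp, Finset.card_univ, Fintype.card_fin] at this
    omega
  refine ⟨?_, fun G hG hGc => isMultFree_of_evenEven_lt (by omega) hp hn hG hGc⟩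
  refine not_isMultFree_evenEven (by omega) Fin.revPerm fun i => ?_
  rw [Fin.revPerm_apply, Fin.val_rev]
  omega
end
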